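/- Every planar graph on n vertices (equivalently, every graph on n vertices with no K₅ minor and no K₃,₃ minor) is a minor of the 4n × 4n grid graph. -/

import Mathlib

/-- `φ` is a minor model of `H` in `G`: branch sets are connected (hence nonempty) and
pairwise disjoint, and every edge of `H` is realized by an edge of `G` between the
corresponding branch sets. -/
def IsMinorModel {V W : Type} (G : SimpleGraph V) (H : SimpleGraph W) (φ : W → Set V) :
    Prop :=
  (∀ w : W, (G.induce (φ w)).Connected) ∧
  (∀ w₁ w₂ : W, w₁ ≠ w₂ → Disjoint (φ w₁) (φ w₂)) ∧
  (∀ w₁ w₂ : W, H.Adj w₁ w₂ → ∃ x ∈ φ w₁, ∃ y ∈ φ w₂, G.Adj x y)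

/-- `H` is a minor of `G`. -/
def IsMinorOf {W V : Type} (H : SimpleGraph W) (G : SimpleGraph V) : Prop :=
  ∃ φ : W → Set V, IsMinorModel G H φ
/-- The complete graph on five vertices. -/
def K5 : SimpleGraph (Fin 5) := ⊤

/-- The complete bipartite graph with parts of size three. -/
def K33 : SimpleGraph (Fin 3 ⊕ Fin 3) := completeBipartiteGraph (Fin 3) (Fin 3)

/-- The `m × m` grid graph: vertices `[m] × [m]`, with `(a, b)` adjacent to `(c, d)`
iff `|a - c| + |b - d| = 1`. -/
def gridGraph (m : ℕ) : SimpleGraph (Fin m × Fin m) :=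
  SimpleGraph.fromRel (fun p q =>
    (p.1 = q.1 ∧ (p.2 : ℕ) + 1 = (q.2 : ℕ)) ∨ (p.2 = q.2 ∧ (p.1 : ℕ) + 1 = (q.1 : ℕ)))

namespace GM

/-- Reachability inside the vertex set `S`. -/
def Reach {V : Type} (G : SimpleGraph V) (S : Set V) : V → V → Prop :=
  Relation.ReflTransGen (fun u v => G.Adj u v ∧ u ∈ S ∧ v ∈ S)

/-- `S` is nonempty and induces a connected subgraph. -/
def Conn {V : Type} (G : SimpleGraph V) (S : Set V) : Prop :=
  S.Nonempty ∧ ∀ x ∈ S, ∀ y ∈ S, Reach G S x y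

/-- The component of `x` in the subgraph induced by `S`. -/
def comp {V : Type} (G : SimpleGraph V) (S : Set V) (x : V) : Set V := {y | Reach G S x y}

variable {V : Type} {G : SimpleGraph V} {S T : Set V}

theorem Reach.mono {G' : SimpleGraph V} (hG : G ≤ G') (h : S ⊆ T) {x y : V}
    (hr : Reach G S x y) : Reach G' T x y :=
  Relation.ReflTransGen.mono (fun _ _ ⟨a, b, c⟩ => ⟨hG a, h b, h c⟩) _ _ hr

theorem Reach.symm {x y : V} (hr : Reach G S x y) : Reach G S y x := by
  induction hr with
  | refl => exact .refl
  | tail _ h ih => exact .head ⟨h.1.symm, h.2.2, h.2.1⟩ ih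

theorem Reach.mem {x y : V} (hr : Reach G S x y) (hx : x ∈ S) : y ∈ S := by
  induction hr with
  | refl => exact hx
  | tail _ h ih => exact h.2.2

theorem Reach.one {x y : V} (h : G.Adj x y) (hx : x ∈ S) (hy : y ∈ S) : Reach G S x y :=
  .single ⟨h, hx, hy⟩

theorem Conn.singleton (x : V) : Conn G {x} := by
  refine ⟨⟨x, rfl⟩, ?_⟩
  rintro _ rfl _ rfl
  exact .refl

/-- Enlarging a connected set by vertices that reach it. -/
theorem Conn.extend (hT : Conn G T) (hTS : T ⊆ S)
    (h : ∀ x ∈ S, ∃ t ∈ T, Reach G S x t) : Conn G S := by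
  obtain ⟨⟨t0, ht0⟩, hT⟩ := hT
  refine ⟨⟨t0, hTS ht0⟩, fun x hx y hy => ?_⟩
  obtain ⟨t, ht, h1⟩ := h x hx
  obtain ⟨t', ht', h2⟩ := h y hy
  exact (h1.trans ((hT t ht t' ht').mono le_rfl hTS)).trans h2.symm

theorem Conn.union (hS : Conn G S) (hT : Conn G T)
    (h : ∃ s ∈ S, ∃ t ∈ T, s = t ∨ G.Adj s t) : Conn G (S ∪ T) := by
  obtain ⟨s, hs, t, ht, h⟩ := h
  refine hS.extend Set.subset_union_left ?_
  rintro x (hx | hx)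
  · exact ⟨x, hx, .refl⟩
  · refine ⟨s, hs, ?_⟩
    have h1 := (hT.2 x hx t ht).mono (G' := G) le_rfl (Set.subset_union_right (s := S))
    rcases h with rfl | h
    · exact h1
    · exact h1.trans (Reach.one h.symm (Or.inr ht) (Or.inl hs))

theorem comp_sub {x : V} (hx : x ∈ S) : comp G S x ⊆ S := fun _ hy => Reach.mem hy hx

theorem mem_comp (x : V) : x ∈ comp G S x := .refl

theorem comp_conn (x : V) : Conn G (comp G S x) := by
  have key : ∀ y, Reach G S x y → Reach G (comp G S x) x y := by
    intro y hy
    induction hy with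
    | refl => exact .refl
    | tail h1 h2 ih => exact ih.tail ⟨h2.1, h1, Relation.ReflTransGen.tail h1 h2⟩
  refine ⟨⟨x, .refl⟩, fun y hy z hz => (key y hy).symm.trans (key z hz)⟩

theorem comp_closed {x u v : V} (hx : x ∈ S) (hu : u ∈ comp G S x) (hv : v ∈ S)
    (h : G.Adj u v) : v ∈ comp G S x :=
  Relation.ReflTransGen.tail hu ⟨h, comp_sub hx hu, hv⟩

theorem Conn.sub_comp (hT : Conn G T) (hTS : T ⊆ S) {x : V} (hx : x ∈ T) :
    T ⊆ comp G S x := fun y hy => (hT.2 x hx y hy).mono le_rfl hTS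

/-- An edge leaving a proper nonempty part of a connected set. -/
theorem Conn.exists_edge (hS : Conn G S) {A : Set V} {x y : V} (hx : x ∈ S) (hxA : x ∈ A)
    (hy : y ∈ S) (hyA : y ∉ A) : ∃ u ∈ S, u ∈ A ∧ ∃ v ∈ S, v ∉ A ∧ G.Adj u v := by
  have h := hS.2 x hx y hy
  induction h with
  | refl => exact absurd hxA hyA
  | @tail b c h1 h2 ih =>
    by_cases hb : b ∈ A
    · exact ⟨b, h2.2.1, hb, c, h2.2.2, hyA, h2.1⟩
    · exact ih h2.2.1 hb

/-- If `Q` is closed under adjacency in `B \ {b}`, the rest of `B` still reaches `b`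
without using `Q`. -/
theorem Conn.reach_avoid {B Q : Set V} (hB : Conn G B) {b y : V} (hb : b ∈ B)
    (hQ : ∀ u ∈ Q, ∀ v ∈ B, v ≠ b → G.Adj u v → v ∈ Q) (hbQ : b ∉ Q) (hy : y ∈ B)
    (hyQ : y ∉ Q) : Reach G (B \ Q) y b := by
  have h := hB.2 y hy b hb
  induction h using Relation.ReflTransGen.head_induction_on with
  | refl => exact .refl
  | @head u v h1 h2 ih =>
    by_cases hub : u = b
    · subst hub; exact .refl
    · have hv : v ∉ Q := fun hv => hyQ (hQ v hv u h1.2.1 hub h1.1.symm)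
      exact Relation.ReflTransGen.head ⟨h1.1, ⟨h1.2.1, hyQ⟩, ⟨h1.2.2, hv⟩⟩ (ih h1.2.2 hv)

theorem Conn.induce (h : Conn G S) : (G.induce S).Connected := by
  obtain ⟨⟨x0, hx0⟩, h⟩ := h
  have key : ∀ x y (hx : x ∈ S) (hy : y ∈ S), Reach G S x y →
      (G.induce S).Reachable ⟨x, hx⟩ ⟨y, hy⟩ := by
    intro x y hx hy hr
    induction hr with
    | refl => exact .refl _
    | @tail b c h1 h2 ih =>
      refine (ih h2.2.1).trans (SimpleGraph.Adj.reachable ?_)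
      exact h2.1
  have : Nonempty S := ⟨⟨x0, hx0⟩⟩
  exact ⟨fun x y => key x y x.2 y.2 (h x x.2 y y.2)⟩

/-- `H` has a minor model in `G` with all branch sets inside `U`. -/
def Has {W : Type} (H : SimpleGraph W) (G : SimpleGraph V) (U : Set V) : Prop :=
  ∃ φ : W → Set V, (∀ w, Conn G (φ w)) ∧ (∀ w₁ w₂, w₁ ≠ w₂ → Disjoint (φ w₁) (φ w₂)) ∧
    (∀ w₁ w₂, H.Adj w₁ w₂ → ∃ x ∈ φ w₁, ∃ y ∈ φ w₂, G.Adj x y) ∧ ∀ w, φ w ⊆ U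

/-- No Kuratowski minor inside `U`. -/
def Free (G : SimpleGraph V) (U : Set V) : Prop := ¬ Has K5 G U ∧ ¬ Has K33 G U

theorem Has.mono {W : Type} {H : SimpleGraph W} (hST : S ⊆ T) (h : Has H G S) : Has H G T := by
  obtain ⟨φ, h1, h2, h3, h4⟩ := h
  exact ⟨φ, h1, h2, h3, fun w => (h4 w).trans hST⟩

theorem Free.mono (hST : S ⊆ T) (h : Free G T) : Free G S :=
  ⟨fun h' => h.1 (h'.mono hST), fun h' => h.2 (h'.mono hST)⟩

/-- A virtual edge `x y` can be simulated by a connected set `K` outside of `U`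
adjacent to both ends. -/
theorem Has.virtual {W : Type} {H : SimpleGraph W} {U K : Set V} {x y : V}
    (hK : Conn G K) (hUK : Disjoint U K) (hx : ∃ k ∈ K, G.Adj x k) (hy : ∃ k ∈ K, G.Adj y k)
    (h : Has H (G ⊔ SimpleGraph.edge x y) U) : Has H G (U ∪ K) := by
  classical
  obtain ⟨φ, h1, h2, h3, h4⟩ := h
  obtain ⟨kx, hkx, hx⟩ := hx
  obtain ⟨ky, hky, hy⟩ := hy
  have hadj : ∀ u v, (G ⊔ SimpleGraph.edge x y).Adj u v →
      G.Adj u v ∨ (u = x ∧ v = y) ∨ (u = y ∧ v = x) := by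
    intro u v huv
    rcases huv with h | h
    · exact Or.inl h
    · rw [SimpleGraph.edge_adj] at h
      tauto
  let ψ : W → Set V := fun w => if x ∈ φ w then φ w ∪ K else φ w
  have hsub : ∀ w, φ w ⊆ ψ w := by
    intro w v hv
    by_cases hw : x ∈ φ w
    · simp only [ψ, if_pos hw]; exact Or.inl hv
    · simp only [ψ, if_neg hw]; exact hv
  refine ⟨ψ, ?_, ?_, ?_, ?_⟩
  · intro w
    by_cases hw : x ∈ φ w
    · simp only [ψ, if_pos hw]
      refine hK.extend Set.subset_union_right ?_
      rintro v (hv | hv)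
      · refine ⟨kx, hkx, ?_⟩
        have hr := (h1 w).2 v hv x hw
        have hx' : Reach G (φ w ∪ K) x kx := Reach.one hx (Or.inl hw) (Or.inr hkx)
        induction hr using Relation.ReflTransGen.head_induction_on with
        | refl => exact hx'
        | @head a b ha hb ih =>
          rcases hadj _ _ ha.1 with h | ⟨rfl, rfl⟩ | ⟨rfl, rfl⟩
          · exact (Reach.one h (Or.inl hv) (Or.inl ha.2.2)).trans (ih ha.2.2)
          · exact hx'
          · exact (Reach.one hy (Or.inl hv) (Or.inr hky)).trans
              ((hK.2 ky hky kx hkx).mono le_rfl Set.subset_union_right)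
      · exact ⟨v, hv, .refl⟩
    · simp only [ψ, if_neg hw]
      refine ⟨(h1 w).1, fun a ha b hb => ?_⟩
      refine Relation.ReflTransGen.mono ?_ _ _ ((h1 w).2 a ha b hb)
      rintro u v ⟨huv, hu, hv⟩
      refine ⟨?_, hu, hv⟩
      rcases hadj _ _ huv with h | ⟨rfl, rfl⟩ | ⟨rfl, rfl⟩
      · exact h
      · exact absurd hu hw
      · exact absurd hv hw
  · intro w w' hne
    have hd := h2 w w' hne
    have hKw : ∀ w, Disjoint (φ w) K := fun w => hUK.mono_left (h4 w)
    by_cases hw : x ∈ φ w <;> by_cases hw' : x ∈ φ w'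
    · exact absurd hw' (Set.disjoint_left.1 hd hw)
    · simp only [ψ, if_pos hw, if_neg hw', Set.disjoint_union_left]
      exact ⟨hd, (hKw w').symm⟩
    · simp only [ψ, if_neg hw, if_pos hw', Set.disjoint_union_right]
      exact ⟨hd, hKw w⟩
    · simp only [ψ, if_neg hw, if_neg hw']; exact hd
  · intro w w' hww
    obtain ⟨a, ha, b, hb, hab⟩ := h3 w w' hww
    rcases hadj _ _ hab with h | ⟨rfl, rfl⟩ | ⟨rfl, rfl⟩
    · exact ⟨a, hsub w ha, b, hsub w' hb, h⟩
    · exact ⟨ky, by simp only [ψ, if_pos ha]; exact Or.inr hky, b, hsub w' hb, hy.symm⟩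
    · exact ⟨a, hsub w ha, ky, by simp only [ψ, if_pos hb]; exact Or.inr hky, hy⟩
  · intro w
    by_cases hw : x ∈ φ w
    · simp only [ψ, if_pos hw]; exact Set.union_subset_union_left _ (h4 w)
    · simp only [ψ, if_neg hw]; exact (h4 w).trans Set.subset_union_left

end GM

namespace GM
variable {V : Type}

/-- Sweep runs on words: `Run w I P t w'` goes from the word `w` to `w'` in `t` moves, inserting
the vertices of `I` and seeing the pairs of `P` as consecutive letters. -/
inductive Run : List V → Set V → Set (V × V) → ℕ → List V → Prop
  | nil (w : List V) : Run w ∅ ∅ 0 w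
  | see (α : List V) (a b : V) (β : List V) :
      Run (α ++ a :: b :: β) ∅ {(a, b)} 0 (α ++ a :: b :: β)
  | ins (α : List V) (a v : V) (β : List V) : Run (α ++ a :: β) {v} ∅ 1 (α ++ a :: v :: β)
  | dup (α : List V) (a : V) (β : List V) : Run (α ++ a :: β) ∅ ∅ 1 (α ++ a :: a :: β)
  | del (α : List V) (a u : V) (β : List V) : Run (α ++ a :: u :: β) ∅ ∅ 1 (α ++ a :: β)
  | trans {w w' w'' : List V} {I I' : Set V} {P P' : Set (V × V)} {t t' : ℕ} :
      Run w I P t w' → Run w' I' P' t' w'' → Disjoint I I' →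
      Run w (I ∪ I') (P ∪ P') (t + t') w''
  | weak {w w' : List V} {I : Set V} {P P' : Set (V × V)} {t : ℕ} :
      Run w I P t w' → P' ⊆ P → Run w I P' t w'

theorem Run.context {w w' : List V} {I : Set V} {P : Set (V × V)} {t : ℕ}
    (h : Run w I P t w') (γ δ : List V) : Run (γ ++ w ++ δ) I P t (γ ++ w' ++ δ) := by
  induction h with
  | nil w => exact .nil _
  | see α a b β => simpa using Run.see (γ ++ α) a b (β ++ δ)
  | ins α a v β => simpa using Run.ins (γ ++ α) a v (β ++ δ)
  | dup α a β => simpa using Run.dup (γ ++ α) a (β ++ δ)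
  | del α a u β => simpa using Run.del (γ ++ α) a u (β ++ δ)
  | trans _ _ hd ih1 ih2 => exact .trans ih1 ih2 hd
  | weak _ hP ih => exact .weak ih hP

theorem Run.splice {w w' : List V} {I J : Set V} {P Q : Set (V × V)} {t t2 : ℕ} {x y : V}
    (h : Run w I P t w') (hxy : (x, y) ∈ P) (h2 : Run [x, y] J Q t2 [x, y])
    (hd : Disjoint I J) : Run w (I ∪ J) (P ∪ Q) (t + t2) w' := by
  induction h with
  | nil w => simp at hxy
  | see α a b β =>
    simp only [Set.mem_singleton_iff, Prod.mk.injEq] at hxy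
    obtain ⟨rfl, rfl⟩ := hxy
    have := h2.context α β
    simp only [List.append_assoc, List.cons_append, List.nil_append] at this
    exact (Run.see α x y β).trans this (by simp)
  | ins α a v β => simp at hxy
  | dup α a β => simp at hxy
  | del α a u β => simp at hxy
  | @trans w w' w'' I I' P P' t t' h h' hdd ih1 ih2 =>
    rw [Set.disjoint_union_left] at hd
    rcases hxy with hxy | hxy
    · have := (ih1 hxy hd.1).trans h' (by rw [Set.disjoint_union_left]; exact ⟨hdd, hd.2.symm⟩)
      convert this using 1
      · ext z; simp; tauto
      · ext z; simp; tauto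
      · omega
    · have := h.trans (ih2 hxy hd.2) (by rw [Set.disjoint_union_right]; exact ⟨hdd, hd.1⟩)
      convert this using 1
      · ext z; simp; tauto
      · ext z; simp; tauto
      · omega
  | weak h hP ih =>
    exact (ih (hP hxy) hd).weak (Set.union_subset_union_left _ hP)

/-- Neighbouring cells. -/
def adj4 (p q : ℕ × ℕ) : Prop :=
  (p.1 = q.1 ∧ (p.2 + 1 = q.2 ∨ q.2 + 1 = p.2)) ∨ (p.2 = q.2 ∧ (p.1 + 1 = q.1 ∨ q.1 + 1 = p.1))

theorem adj4.symm {p q : ℕ × ℕ} (h : adj4 p q) : adj4 q p := by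
  unfold adj4 at *; omega

/-- Cells of the rectangle with rows `0..h` and columns `0..m-1`. -/
def inR (h m : ℕ) (p : ℕ × ℕ) : Prop := p.1 ≤ h ∧ p.2 < m

def CR (f : ℕ × ℕ → V) (h m : ℕ) (p q : ℕ × ℕ) : Prop :=
  adj4 p q ∧ inR h m p ∧ inR h m q ∧ f p = f q

theorem CR.symm {f : ℕ × ℕ → V} {h m : ℕ} {p q : ℕ × ℕ} (hh : CR f h m p q) : CR f h m q p :=
  ⟨hh.1.symm, hh.2.2.1, hh.2.1, hh.2.2.2.symm⟩

theorem CRt.symm {f : ℕ × ℕ → V} {h m : ℕ} {p q : ℕ × ℕ}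
    (hh : Relation.ReflTransGen (CR f h m) p q) : Relation.ReflTransGen (CR f h m) q p := by
  induction hh with
  | refl => exact .refl
  | tail _ h ih => exact .head h.symm ih

/-- A labelled rectangle all of whose label classes are connected. -/
structure Core (f : ℕ × ℕ → V) (h m : ℕ) (S : Set V) (P : Set (V × V)) : Prop where
  lab : ∀ p, inR h m p → f p ∈ S
  occ : ∀ v ∈ S, ∃ p, inR h m p ∧ f p = v
  conn : ∀ p q, inR h m p → inR h m q → f p = f q → Relation.ReflTransGen (CR f h m) p q
  see : ∀ x ∈ P, ∃ p q, inR h m p ∧ inR h m q ∧ adj4 p q ∧ f p = x.1 ∧ f q = x.2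

def colDup (j : ℕ) (p : ℕ × ℕ) : ℕ × ℕ := (p.1, if p.2 ≤ j then p.2 else p.2 - 1)

theorem colDup_inR {j h m : ℕ} (hj : j < m) {p : ℕ × ℕ} (hp : inR h (m + 1) p) :
    inR h m (colDup j p) := by
  unfold inR colDup at *
  refine ⟨hp.1, ?_⟩
  dsimp only
  split_ifs <;> omega

theorem colDup_lift {j h m : ℕ} {a b : ℕ × ℕ} (hab : adj4 a b)
    (ha : inR h m a) (hb : inR h m b) : ∃ p q, colDup j p = a ∧ colDup j q = b ∧ adj4 p q ∧
      inR h (m + 1) p ∧ inR h (m + 1) q := by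
  obtain ⟨a1, a2⟩ := a
  obtain ⟨b1, b2⟩ := b
  unfold inR adj4 at *
  dsimp only at *
  by_cases hmin : j ≤ min a2 b2
  · refine ⟨(a1, a2 + 1), (b1, b2 + 1), ?_, ?_, ?_, ?_, ?_⟩
    · unfold colDup; dsimp only; rw [if_neg (by omega)]; simp
    · unfold colDup; dsimp only; rw [if_neg (by omega)]; simp
    all_goals dsimp only; omega
  · refine ⟨(a1, a2), (b1, b2), ?_, ?_, ?_, ?_, ?_⟩
    · unfold colDup; dsimp only; rw [if_pos (by omega)]
    · unfold colDup; dsimp only; rw [if_pos (by omega)]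
    all_goals dsimp only; omega

theorem Core.dupcol {f : ℕ × ℕ → V} {h m j : ℕ} {S : Set V} {P : Set (V × V)}
    (hc : Core f h m S P) (hj : j < m) : Core (f ∘ colDup j) h (m + 1) S P := by
  have base : ∀ p q, colDup j p = colDup j q → inR h (m + 1) p → inR h (m + 1) q →
      Relation.ReflTransGen (CR (f ∘ colDup j) h (m + 1)) p q := by
    intro p q hpq hp hq
    by_cases h0 : p = q
    · subst h0; exact .refl
    · refine .single ⟨?_, hp, hq, by simp [hpq]⟩
      obtain ⟨p1, p2⟩ := p
      obtain ⟨q1, q2⟩ := q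
      unfold colDup at hpq
      simp only [Prod.mk.injEq] at hpq h0
      obtain ⟨rfl, h2⟩ := hpq
      unfold adj4
      dsimp only
      split_ifs at h2 <;> omega
  constructor
  · intro p hp
    exact hc.lab _ (colDup_inR hj hp)
  · intro v hv
    obtain ⟨p, hp, rfl⟩ := hc.occ v hv
    refine ⟨(p.1, if p.2 ≤ j then p.2 else p.2 + 1), ?_, ?_⟩
    · unfold inR at *
      dsimp only
      refine ⟨hp.1, ?_⟩
      split_ifs <;> omega
    · simp only [Function.comp, colDup]
      congr 1
      ext
      · rfl
      · dsimp only; split_ifs <;> omega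
  · intro p q hp hq hpq
    have key : ∀ a b, Relation.ReflTransGen (CR f h m) a b → ∀ p q, colDup j p = a →
        colDup j q = b → inR h (m + 1) p → inR h (m + 1) q →
        Relation.ReflTransGen (CR (f ∘ colDup j) h (m + 1)) p q := by
      intro a b hab
      induction hab with
      | refl => intro p q h1 h2 hp hq; exact base p q (h1.trans h2.symm) hp hq
      | @tail b c h1 h2 ih =>
        intro p q hpa hqc hp hq
        obtain ⟨p', q', e1, e2, e3, e4, e5⟩ := colDup_lift (j := j) h2.1 h2.2.1 h2.2.2.1
        refine (ih p p' hpa e1 hp e4).trans (.trans (.single ⟨e3, e4, e5, ?_⟩)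
          (base q' q (e2.trans hqc.symm) e5 hq))
        simp only [Function.comp, e1, e2]
        exact h2.2.2.2
    exact key _ _ (hc.conn _ _ (colDup_inR hj hp) (colDup_inR hj hq) hpq) p q rfl rfl hp hq
  · intro x hx
    obtain ⟨a, b, ha, hb, hab, h1, h2⟩ := hc.see x hx
    obtain ⟨p', q', e1, e2, e3, e4, e5⟩ := colDup_lift (j := j) hab ha hb
    exact ⟨p', q', e4, e5, e3, by simp [e1, h1], by simp [e2, h2]⟩

def rowAdd (f : ℕ × ℕ → V) (h : ℕ) (ρ : ℕ → V) (p : ℕ × ℕ) : V :=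
  if p.1 ≤ h then f p else ρ p.2

theorem Core.addrow {f : ℕ × ℕ → V} {h m j : ℕ} {S S' : Set V} {P : Set (V × V)}
    (hc : Core f h m S P) (ρ : ℕ → V)
    (hρ : ∀ c < m, ρ c = f (h, c) ∨ (0 < c ∧ ρ c = ρ (c - 1)) ∨ (ρ c ∉ S ∧ c = j))
    (hS1 : ∀ c < m, ρ c ∈ S') (hS2 : S ⊆ S') (hS3 : ∀ v ∈ S', v ∈ S ∨ ∃ c < m, ρ c = v) :
    Core (rowAdd f h ρ) (h + 1) m S' P := by
  have old : ∀ p, inR h m p → rowAdd f h ρ p = f p := by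
    intro p hp; unfold rowAdd; rw [if_pos hp.1]
  have new : ∀ c, rowAdd f h ρ (h + 1, c) = ρ c := by
    intro c; unfold rowAdd; rw [if_neg (by simp)]
  have up : ∀ p, inR h m p → inR (h + 1) m p := fun p hp => ⟨hp.1.trans (Nat.le_succ _), hp.2⟩
  have split : ∀ p, inR (h + 1) m p → inR h m p ∨ p = (h + 1, p.2) := by
    intro p hp
    by_cases h1 : p.1 ≤ h
    · exact Or.inl ⟨h1, hp.2⟩
    · right; ext
      · have := hp.1; dsimp only; omega
      · rfl
  have lift : ∀ p q, Relation.ReflTransGen (CR f h m) p q →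
      Relation.ReflTransGen (CR (rowAdd f h ρ) (h + 1) m) p q := by
    intro p q hpq
    refine Relation.ReflTransGen.mono ?_ _ _ hpq
    rintro a b ⟨h1, h2, h3, h4⟩
    exact ⟨h1, up _ h2, up _ h3, by rw [old _ h2, old _ h3, h4]⟩
  have key : ∀ c < m,
      (∃ x, inR h m x ∧ f x = ρ c ∧
        Relation.ReflTransGen (CR (rowAdd f h ρ) (h + 1) m) (h + 1, c) x) ∨
      (ρ c ∉ S ∧ Relation.ReflTransGen (CR (rowAdd f h ρ) (h + 1) m) (h + 1, c) (h + 1, j)) := by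
    intro c
    induction c with
    | zero =>
      intro hcm
      rcases hρ 0 hcm with h0 | h0 | h0
      · left
        refine ⟨(h, 0), ⟨le_rfl, hcm⟩, h0.symm, .single ⟨?_, ⟨le_rfl, hcm⟩, up _ ⟨le_rfl, hcm⟩, ?_⟩⟩
        · unfold adj4; simp
        · rw [new, old _ ⟨le_rfl, hcm⟩, h0]
      · omega
      · right; refine ⟨h0.1, ?_⟩; rw [← h0.2]
    | succ c ih =>
      intro hcm
      rcases hρ (c + 1) hcm with h0 | h0 | h0
      · left
        refine ⟨(h, c + 1), ⟨le_rfl, hcm⟩, h0.symm,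
          .single ⟨?_, ⟨le_rfl, hcm⟩, up _ ⟨le_rfl, hcm⟩, ?_⟩⟩
        · unfold adj4; simp
        · rw [new, old _ ⟨le_rfl, hcm⟩, h0]
      · have h1 : ρ (c + 1) = ρ c := h0.2
        have st : Relation.ReflTransGen (CR (rowAdd f h ρ) (h + 1) m) (h + 1, c + 1) (h + 1, c) := by
          refine .single ⟨?_, ⟨le_rfl, hcm⟩, ⟨le_rfl, by dsimp only; omega⟩, ?_⟩
          · unfold adj4; simp
          · rw [new, new, h1]
        rcases ih (by omega) with ⟨x, hx, hx1, hx2⟩ | ⟨h2, h3⟩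
        · exact Or.inl ⟨x, hx, hx1.trans h1.symm, st.trans hx2⟩
        · exact Or.inr ⟨by rw [h1]; exact h2, st.trans h3⟩
      · right; refine ⟨h0.1, ?_⟩; rw [← h0.2]
  have key2 : ∀ p, inR (h + 1) m p →
      (∃ x, inR h m x ∧ f x = rowAdd f h ρ p ∧
        Relation.ReflTransGen (CR (rowAdd f h ρ) (h + 1) m) p x) ∨
      (rowAdd f h ρ p ∉ S ∧
        Relation.ReflTransGen (CR (rowAdd f h ρ) (h + 1) m) p (h + 1, j)) := by
    intro p hp
    rcases split p hp with h1 | h1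
    · exact Or.inl ⟨p, h1, (old _ h1).symm, .refl⟩
    · rw [h1, new]; exact key _ hp.2
  constructor
  · intro p hp
    rcases split p hp with h1 | h1
    · rw [old _ h1]; exact hS2 (hc.lab _ h1)
    · rw [h1, new]; exact hS1 _ hp.2
  · intro v hv
    rcases hS3 v hv with h1 | ⟨c, hcm, rfl⟩
    · obtain ⟨p, hp, rfl⟩ := hc.occ v h1
      exact ⟨p, up _ hp, old _ hp⟩
    · exact ⟨(h + 1, c), ⟨le_rfl, hcm⟩, new c⟩
  · intro p q hp hq hpq
    rcases key2 p hp with ⟨x, hx, hx1, hx2⟩ | ⟨h1, h2⟩ <;>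
    rcases key2 q hq with ⟨y, hy, hy1, hy2⟩ | ⟨h3, h4⟩
    · exact (hx2.trans (lift _ _ (hc.conn x y hx hy (by rw [hx1, hy1, hpq])))).trans (CRt.symm hy2)
    · exact absurd (by rw [← hpq, ← hx1]; exact hc.lab _ hx) h3
    · exact absurd (by rw [hpq, ← hy1]; exact hc.lab _ hy) h1
    · exact h2.trans (CRt.symm h4)
  · intro x hx
    obtain ⟨a, b, ha, hb, hab, h1, h2⟩ := hc.see x hx
    exact ⟨a, b, up _ ha, up _ hb, hab, by rw [old _ ha, h1], by rw [old _ hb, h2]⟩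

/-- `ρ` arises from `w` by repeating letters. -/
inductive Exp : List V → List V → Prop
  | nil : Exp [] []
  | cons (a : V) (k : ℕ) {w ρ : List V} : Exp w ρ → Exp (a :: w) (List.replicate (k + 1) a ++ ρ)

theorem Exp.append {w ρ w' ρ' : List V} (h : Exp w ρ) (h' : Exp w' ρ') :
    Exp (w ++ w') (ρ ++ ρ') := by
  induction h with
  | nil => exact h'
  | cons a k _ ih => rw [List.append_assoc]; exact .cons a k ih

theorem Exp.split {w w' ρ : List V} (h : Exp (w ++ w') ρ) :
    ∃ ρ1 ρ2, ρ = ρ1 ++ ρ2 ∧ Exp w ρ1 ∧ Exp w' ρ2 := by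
  induction w generalizing ρ with
  | nil => exact ⟨[], ρ, rfl, .nil, h⟩
  | cons a w ih =>
    cases h with
    | @cons _ k _ ρ h =>
      obtain ⟨ρ1, ρ2, rfl, h1, h2⟩ := ih h
      exact ⟨_, ρ2, (List.append_assoc _ _ _).symm, .cons a k h1, h2⟩

theorem Exp.one {a : V} {ρ : List V} (h : Exp [a] ρ) : ∃ k, ρ = List.replicate (k + 1) a := by
  cases h with
  | @cons _ k _ ρ h => cases h; exact ⟨k, by simp⟩

theorem Exp.repl (a : V) (k : ℕ) : Exp [a] (List.replicate (k + 1) a) := by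
  simpa using Exp.cons a k .nil

theorem Exp.splitOne {α β ρ : List V} {a : V} (h : Exp (α ++ a :: β) ρ) :
    ∃ ρ1 k ρ2, ρ = ρ1 ++ (List.replicate k a ++ a :: ρ2) ∧ Exp α ρ1 ∧ Exp β ρ2 := by
  obtain ⟨ρ1, r, rfl, h1, h2⟩ := h.split
  cases h2 with
  | @cons _ k _ ρ h3 => exact ⟨ρ1, k, ρ, by simp [List.replicate_succ'], h1, h3⟩

/-- A picture of a run whose top row is an expansion of `w`. -/
def Pic (w : List V) (S : Set V) (P : Set (V × V)) (h m : ℕ) : Prop :=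
  ∃ f ρ, Core f h m S P ∧ Exp w ρ ∧ ρ.length = m ∧ ∀ c < m, ρ[c]? = some (f (h, c))

theorem Pic.row {w' : List V} {S S' : Set V} {P : Set (V × V)} {h m j : ℕ} {f : ℕ × ℕ → V}
    {ρ ρ' : List V} (hc : Core f h m S P) (hl : ρ.length = m)
    (htop : ∀ c < m, ρ[c]? = some (f (h, c))) (he : Exp w' ρ') (hl' : ρ'.length = m)
    (hrow : ∀ c < m, ρ'[c]? = ρ[c]? ∨ (0 < c ∧ ρ'[c]? = ρ'[c - 1]?) ∨
      ((∀ v, ρ'[c]? = some v → v ∉ S) ∧ c = j))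
    (hS1 : ∀ v ∈ ρ', v ∈ S') (hS2 : S ⊆ S') (hS3 : ∀ v ∈ S', v ∈ S ∨ v ∈ ρ') :
    Pic w' S' P (h + 1) m := by
  let g : ℕ → V := fun c => ρ'.getD c (f (0, 0))
  have hg : ∀ c < m, ρ'[c]? = some (g c) := by
    intro c hcm
    simp only [g, List.getD_eq_getElem?_getD]
    rw [List.getElem?_eq_getElem (by omega)]
    simp
  refine ⟨rowAdd f h g, ρ', hc.addrow (j := j) g ?_ ?_ hS2 ?_, he, hl', ?_⟩
  · intro c hcm
    have h1 := hrow c hcm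
    rw [hg c hcm, htop c hcm] at h1
    rcases h1 with h1 | h1 | h1
    · left; simpa using h1
    · right; left
      refine ⟨h1.1, ?_⟩
      have := h1.2
      rw [hg (c - 1) (by omega)] at this
      simpa using this
    · right; right
      exact ⟨h1.1 _ rfl, h1.2⟩
  · intro c hcm
    exact hS1 _ (List.mem_of_getElem? (hg c hcm))
  · intro v hv
    rcases hS3 v hv with h1 | h1
    · exact Or.inl h1
    · right
      obtain ⟨c, hcl, rfl⟩ := List.mem_iff_getElem.1 h1
      refine ⟨c, by omega, ?_⟩
      have := hg c (by omega)
      rw [List.getElem?_eq_getElem hcl] at this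
      simpa using this.symm
  · intro c hcm
    rw [hg c hcm]; unfold rowAdd; simp

theorem Pic.mem {w : List V} {S : Set V} {ρ : List V} {f : ℕ × ℕ → V} {h m : ℕ}
    {P : Set (V × V)} (hc : Core f h m S P) (hl : ρ.length = m)
    (htop : ∀ c < m, ρ[c]? = some (f (h, c))) : ∀ v ∈ ρ, v ∈ S := by
  intro v hv
  obtain ⟨c, hcl, rfl⟩ := List.mem_iff_getElem.1 hv
  have := htop c (by omega)
  rw [List.getElem?_eq_getElem hcl] at this
  simp only [Option.some.injEq] at this
  rw [this]
  exact hc.lab _ ⟨le_rfl, by dsimp only; omega⟩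

theorem Pic.dupins {α β : List V} {a v : V} {S : Set V} {P : Set (V × V)} {h m : ℕ}
    (hp : Pic (α ++ a :: β) S P h m) (hv : v ∉ S ∨ v = a) :
    Pic (α ++ a :: v :: β) (S ∪ {v}) P (h + 1) (m + 1) := by
  obtain ⟨f, ρ, hc, he, hl, htop⟩ := hp
  have hmem := Pic.mem (w := []) hc hl htop
  obtain ⟨ρ1, k, ρ2, rfl, h1, h2⟩ := he.splitOne
  rw [← List.append_assoc] at *
  set σ := ρ1 ++ List.replicate k a with hσ
  simp only [List.length_append, List.length_cons] at hl
  have hj : σ.length < m := by omega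
  refine Pic.row (j := σ.length + 1) (ρ := σ ++ a :: a :: ρ2) (ρ' := σ ++ a :: v :: ρ2)
    (hc.dupcol hj) (by simp; omega) ?_ ?_ (by simp; omega) ?_ ?_ Set.subset_union_left ?_
  · intro c hcm
    simp only [Function.comp, colDup]
    by_cases hcj : c ≤ σ.length
    · rw [if_pos hcj, ← htop c (by omega)]
      simp only [List.getElem?_append, List.getElem?_cons]
      grind
    · rw [if_neg hcj, ← htop (c - 1) (by omega)]
      simp only [List.getElem?_append, List.getElem?_cons]
      grind
  · rw [hσ, List.append_assoc]
    refine h1.append ?_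
    have := (Exp.repl a k).append ((Exp.repl v 0).append h2)
    simpa [List.replicate_succ'] using this
  · intro c hcm
    by_cases hcj : c = σ.length + 1
    · rcases hv with hv | rfl
      · right; right
        refine ⟨?_, hcj⟩
        intro u hu
        subst hcj
        simp at hu
        rwa [← hu]
      · left; rfl
    · left
      simp only [List.getElem?_append, List.getElem?_cons]
      grind
  · intro u hu
    have : u = v ∨ u ∈ σ ++ a :: ρ2 := by simp at hu ⊢; tauto
    rcases this with h | h
    · exact Or.inr h
    · exact Or.inl (hmem u h)
  · rintro u (h | h)
    · exact Or.inl h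
    · right; simp at h; simp [h]

theorem Pic.wide {w : List V} {S : Set V} {P : Set (V × V)} {h m : ℕ} (hp : Pic w S P h m)
    (hw : w ≠ []) : Pic w S P h (m + 1) := by
  obtain ⟨f, ρ, hc, he, hl, htop⟩ := hp
  obtain ⟨a, w, rfl⟩ := List.exists_cons_of_ne_nil hw
  cases he with
  | @cons _ k _ ρ h1 =>
    simp only [List.length_append, List.length_replicate] at hl
    refine ⟨_, List.replicate (k + 1 + 1) a ++ ρ, hc.dupcol (j := 0) (by omega),
      .cons a (k + 1) h1, by simp; omega, ?_⟩
    intro c hcm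
    simp only [Function.comp, colDup]
    by_cases hcj : c ≤ 0
    · rw [if_pos hcj, ← htop c (by omega)]
      simp only [List.getElem?_append, List.getElem?_replicate]
      grind
    · rw [if_neg hcj, ← htop (c - 1) (by omega)]
      simp only [List.getElem?_append, List.getElem?_replicate]
      grind

theorem Pic.delete {α β : List V} {a u : V} {S : Set V} {P : Set (V × V)} {h m : ℕ}
    (hp : Pic (α ++ a :: u :: β) S P h m) : Pic (α ++ a :: β) S P (h + 1) m := by
  obtain ⟨f, ρ, hc, he, hl, htop⟩ := hp
  have hmem := Pic.mem (w := []) hc hl htop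
  obtain ⟨ρ1, k, ρ2, rfl, h1, h2⟩ := he.splitOne
  rw [← List.append_assoc] at *
  set σ := ρ1 ++ List.replicate k a with hσ
  cases h2 with
  | @cons _ l _ ρ2 h2 =>
    simp only [List.length_append, List.length_cons, List.length_replicate] at hl
    refine Pic.row (j := 0) (ρ' := σ ++ a :: (List.replicate (l + 1) a ++ ρ2)) hc
      (by simp; omega) htop ?_ (by simp; omega) ?_ ?_ le_rfl (fun v hv => Or.inl hv)
    · rw [hσ, List.append_assoc]
      refine h1.append ?_
      have := (Exp.repl a (k + l + 1)).append h2
      rw [show k + l + 1 + 1 = k + (l + 1 + 1) by omega, List.replicate_add,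
        List.replicate_succ (n := l + 1)] at this
      simpa using this
    · intro c hcm
      by_cases hcj : c ≤ σ.length
      · left
        simp only [List.getElem?_append, List.getElem?_cons]
        grind
      · by_cases hc2 : c ≤ σ.length + (l + 1)
        · right; left
          refine ⟨by omega, ?_⟩
          simp only [List.getElem?_append, List.getElem?_cons, List.getElem?_replicate]
          grind
        · left
          simp only [List.getElem?_append, List.getElem?_cons, List.getElem?_replicate]
          grind
    · intro v hv
      apply hmem
      simp at hv ⊢
      tauto

theorem Pic.seePair {α β : List V} {a b : V} {S : Set V} {P : Set (V × V)} {h m : ℕ}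
    (hp : Pic (α ++ a :: b :: β) S P h m) : Pic (α ++ a :: b :: β) S (P ∪ {(a, b)}) h m := by
  obtain ⟨f, ρ, hc, he, hl, htop⟩ := hp
  refine ⟨f, ρ, ⟨hc.lab, hc.occ, hc.conn, ?_⟩, he, hl, htop⟩
  rintro x (hx | hx)
  · exact hc.see x hx
  · obtain rfl := hx
    obtain ⟨ρ1, k, ρ2, rfl, h1, h2⟩ := he.splitOne
    rw [← List.append_assoc] at *
    set σ := ρ1 ++ List.replicate k a with hσ
    cases h2 with
    | @cons _ l _ ρ2 h2 =>
      simp only [List.length_append, List.length_cons, List.length_replicate] at hl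
      refine ⟨(h, σ.length), (h, σ.length + 1), ⟨le_rfl, by dsimp only; omega⟩,
        ⟨le_rfl, by dsimp only; omega⟩, Or.inl ⟨rfl, Or.inl rfl⟩, ?_, ?_⟩
      · have := htop σ.length (by omega)
        simpa using this.symm
      · have := htop (σ.length + 1) (by omega)
        simpa [List.replicate_succ] using this.symm

theorem Pic.run {w w' : List V} {I : Set V} {P : Set (V × V)} {t : ℕ} (hr : Run w I P t w') :
    ∀ {S : Set V} {P0 : Set (V × V)} {h m : ℕ}, Pic w S P0 h m → Disjoint S I →
      Pic w' (S ∪ I) (P0 ∪ P) (h + t) (m + t) := by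
  induction hr with
  | nil w => intro S P0 h m hp _; simpa using hp
  | see α a b β => intro S P0 h m hp _; simpa using hp.seePair
  | ins α a v β =>
    intro S P0 h m hp hd
    simpa using hp.dupins (Or.inl (by simpa using hd))
  | dup α a β =>
    intro S P0 h m hp hd
    have h1 := hp.dupins (v := a) (Or.inr rfl)
    have ha : a ∈ S := by
      obtain ⟨f, ρ, hc, he, hl, htop⟩ := hp
      have hmem := Pic.mem (w := []) hc hl htop
      obtain ⟨ρ1, k, ρ2, rfl, h1, h2⟩ := he.splitOne
      exact hmem a (by simp)
    simpa [Set.insert_eq_of_mem ha] using h1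
  | del α a u β =>
    intro S P0 h m hp hd
    have := hp.delete.wide (by simp)
    simpa using this
  | trans _ _ hdd ih1 ih2 =>
    intro S P0 h m hp hd
    rw [Set.disjoint_union_right] at hd
    have := ih2 (ih1 hp hd.1) (by rw [Set.disjoint_union_left]; exact ⟨hd.2, hdd⟩)
    simpa only [Set.union_assoc, add_assoc] using this
  | weak _ hP ih =>
    intro S P0 h m hp hd
    obtain ⟨f, ρ, hc, h2⟩ := ih hp hd
    exact ⟨f, ρ, ⟨hc.lab, hc.occ, hc.conn, fun x hx =>
      hc.see x (Set.union_subset_union_right _ hP hx)⟩, h2⟩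

/-- The starting picture. -/
theorem Pic.start (x y : V) (hxy : x ≠ y) : Pic [x, y] {x, y} ∅ 0 2 := by
  refine ⟨fun p => if p.2 = 0 then x else y, [x, y], ⟨?_, ?_, ?_, by simp⟩, ?_, rfl, ?_⟩
  · intro p hp; split_ifs <;> simp
  · rintro v (rfl | rfl)
    · exact ⟨(0, 0), by simp [inR], by simp⟩
    · exact ⟨(0, 1), by simp [inR], by simp⟩
  · rintro ⟨p1, p2⟩ ⟨q1, q2⟩ ⟨hp1, hp2⟩ ⟨hq1, hq2⟩ h
    dsimp only at *
    have : (p1, p2) = (q1, q2) := by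
      ext
      · omega
      · by_contra hne
        have : (p2 = 0 ∧ q2 = 1) ∨ (p2 = 1 ∧ q2 = 0) := by omega
        rcases this with ⟨rfl, rfl⟩ | ⟨rfl, rfl⟩
        · simp at h; exact hxy h
        · simp at h; exact hxy h.symm
    rw [this]
  · have := (Exp.repl x 0).append (Exp.repl y 0)
    simpa using this
  · intro c hc
    interval_cases c <;> simp

theorem grid_adj {M : ℕ} {p q : Fin M × Fin M} (h : adj4 (p.1, p.2) (q.1, q.2)) :
    (gridGraph M).Adj p q := by
  obtain ⟨p1, p2⟩ := p
  obtain ⟨q1, q2⟩ := q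
  unfold gridGraph
  rw [SimpleGraph.fromRel_adj]
  unfold adj4 at h
  simp only [ne_eq, Prod.mk.injEq, Fin.ext_iff] at *
  omega

/-- A picture realizing every edge yields a minor of the grid. -/
theorem Pic.minor {w : List V} {G : SimpleGraph V} {P : Set (V × V)} {h m M : ℕ}
    (hp : Pic w Set.univ P h m) (hP : ∀ u v, G.Adj u v → (u, v) ∈ P ∨ (v, u) ∈ P)
    (hh : h < M) (hm : m ≤ M) : IsMinorOf G (gridGraph M) := by
  obtain ⟨f, ρ, hc, -⟩ := hp
  let φ : V → Set (Fin M × Fin M) := fun v =>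
    {p | inR h m (p.1, p.2) ∧ f (p.1, p.2) = v}
  have cell : ∀ p : ℕ × ℕ, inR h m p → ∃ p' : Fin M × Fin M, ((p'.1 : ℕ), (p'.2 : ℕ)) = p := by
    intro p hp
    exact ⟨(⟨p.1, lt_of_le_of_lt hp.1 hh⟩, ⟨p.2, lt_of_lt_of_le hp.2 hm⟩), rfl⟩
  have inj : ∀ p q : Fin M × Fin M, ((p.1 : ℕ), (p.2 : ℕ)) = ((q.1 : ℕ), (q.2 : ℕ)) → p = q := by
    rintro ⟨p1, p2⟩ ⟨q1, q2⟩ h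
    simpa [Fin.ext_iff] using h
  refine ⟨φ, fun v => Conn.induce ⟨?_, ?_⟩, ?_, ?_⟩
  · obtain ⟨p, hp, hv⟩ := hc.occ v trivial
    obtain ⟨p', rfl⟩ := cell p hp
    exact ⟨p', hp, hv⟩
  · intro p hp q hq
    have hr := hc.conn _ _ hp.1 hq.1 (hp.2.trans hq.2.symm)
    have key : ∀ a, Relation.ReflTransGen (CR f h m) ((p.1 : ℕ), (p.2 : ℕ)) a →
        ∀ q : Fin M × Fin M, ((q.1 : ℕ), (q.2 : ℕ)) = a → Reach (gridGraph M) (φ v) p q := by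
      intro a ha
      induction ha with
      | refl => intro q hq; rw [inj q p hq]; exact .refl
      | @tail b c h1 h2 ih =>
        intro q hq
        obtain ⟨b', rfl⟩ := cell b h2.2.1
        have hb := ih b' rfl
        have hbm : b' ∈ φ v := hb.mem hp
        subst hq
        exact hb.tail ⟨grid_adj h2.1, hbm, h2.2.2.1, h2.2.2.2.symm.trans hbm.2⟩
    exact key _ hr q rfl
  · intro u v huv
    rw [Set.disjoint_left]
    intro p hp hq
    exact huv (hp.2.symm.trans hq.2)
  · intro u v huv
    rcases hP u v huv with h1 | h1
    · obtain ⟨p, q, hp, hq, hpq, e1, e2⟩ := hc.see _ h1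
      obtain ⟨p', rfl⟩ := cell p hp
      obtain ⟨q', rfl⟩ := cell q hq
      exact ⟨p', ⟨hp, e1⟩, q', ⟨hq, e2⟩, grid_adj hpq⟩
    · obtain ⟨p, q, hp, hq, hpq, e1, e2⟩ := hc.see _ h1
      obtain ⟨p', rfl⟩ := cell p hp
      obtain ⟨q', rfl⟩ := cell q hq
      exact ⟨q', ⟨hq, e2⟩, p', ⟨hp, e1⟩, grid_adj hpq.symm⟩

end GM

namespace GM
variable {V : Type} {G : SimpleGraph V}

/-- There is an edge between `S` and `T`. -/
def Touch (G : SimpleGraph V) (S T : Set V) : Prop := ∃ x ∈ S, ∃ y ∈ T, G.Adj x y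

theorem Touch.symm {S T : Set V} (h : Touch G S T) : Touch G T S := by
  obtain ⟨x, hx, y, hy, h⟩ := h
  exact ⟨y, hy, x, hx, h.symm⟩

theorem has_K33 {U : Set V} (a b : Fin 3 → Set V) (ha : ∀ i, Conn G (a i)) (hb : ∀ i, Conn G (b i))
    (haa : ∀ i j, i ≠ j → Disjoint (a i) (a j)) (hbb : ∀ i j, i ≠ j → Disjoint (b i) (b j))
    (hab : ∀ i j, Disjoint (a i) (b j)) (ht : ∀ i j, Touch G (a i) (b j))
    (haU : ∀ i, a i ⊆ U) (hbU : ∀ i, b i ⊆ U) : Has K33 G U := by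
  refine ⟨Sum.elim a b, ?_, ?_, ?_, ?_⟩
  · rintro (i | i) <;> simp [ha, hb]
  · rintro (i | i) (j | j) hne
    · exact haa i j (fun h => hne (by rw [h]))
    · exact hab i j
    · exact (hab j i).symm
    · exact hbb i j (fun h => hne (by rw [h]))
  · rintro (i | i) (j | j) h
    · simp [K33] at h
    · exact ht i j
    · exact (ht j i).symm
    · simp [K33] at h
  · rintro (i | i) <;> simp [haU, hbU]

theorem has_K5 {U : Set V} (a : Fin 5 → Set V) (ha : ∀ i, Conn G (a i))
    (ht : ∀ i j, i < j → Disjoint (a i) (a j) ∧ Touch G (a i) (a j))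
    (haU : ∀ i, a i ⊆ U) : Has K5 G U := by
  refine ⟨a, ha, ?_, ?_, haU⟩
  · intro i j hne
    rcases lt_or_gt_of_ne hne with h | h
    · exact (ht i j h).1
    · exact (ht j i h).1.symm
  · intro i j hne
    have hne : i ≠ j := by rintro rfl; simp at hne
    rcases lt_or_gt_of_ne hne with h | h
    · exact (ht i j h).2
    · exact (ht j i h).2.symm

theorem arc_conn {g : ℕ → V} {k : ℕ} (hadj : ∀ i < k, G.Adj (g i) (g (i + 1))) {i j : ℕ}
    (hij : i < j) (hj : j ≤ k + 1) : Conn G (g '' Set.Ico i j) := by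
  induction j, hij using Nat.le_induction with
  | base => 
    have : Set.Ico i (i + 1) = {i} := by ext; simp; omega
    rw [Nat.succ_eq_add_one, this, Set.image_singleton]
    exact Conn.singleton _
  | succ n hn ih =>
    have : Set.Ico i (n + 1) = Set.Ico i n ∪ {n} := by ext; simp; omega
    rw [this, Set.image_union, Set.image_singleton]
    refine (ih (by omega)).union (Conn.singleton _) ⟨g (n - 1), ⟨n - 1, ⟨?_, ?_⟩, rfl⟩, g n, rfl, Or.inr ?_⟩
    · omega
    · omega
    · have := hadj (n - 1) (by omega)
      rwa [show n - 1 + 1 = n by omega] at this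

/-- A cycle given by a function on `0..k`, with two disjoint touching connected sets. -/
structure Wheel (G : SimpleGraph V) (U : Set V) (g : ℕ → V) (k : ℕ) (B D : Set V) : Prop where
  inj : ∀ i ≤ k, ∀ j ≤ k, g i = g j → i = j
  adj : ∀ i < k, G.Adj (g i) (g (i + 1))
  close : G.Adj (g k) (g 0)
  cB : Conn G B
  cD : Conn G D
  dBD : Disjoint B D
  tBD : Touch G B D
  gB : ∀ i ≤ k, g i ∉ B
  gD : ∀ i ≤ k, g i ∉ D
  gU : ∀ i ≤ k, g i ∈ U
  bU : B ⊆ U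
  dU : D ⊆ U

variable {U B D : Set V} {g : ℕ → V} {k : ℕ}

theorem Wheel.swap (h : Wheel G U g k B D) : Wheel G U g k D B :=
  ⟨h.inj, h.adj, h.close, h.cD, h.cB, h.dBD.symm, h.tBD.symm, h.gD, h.gB, h.gU, h.dU, h.bU⟩

theorem Wheel.arcs_disj (h : Wheel G U g k B D) {i j i' j' : ℕ} (h1 : j ≤ i') (h2 : j' ≤ k + 1) :
    Disjoint (g '' Set.Ico i j) (g '' Set.Ico i' j') := by
  rw [Set.disjoint_left]
  rintro _ ⟨a, ha, rfl⟩ ⟨b, hb, hab⟩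
  simp only [Set.mem_Ico] at ha hb
  have := h.inj b (by omega) a (by omega) hab
  omega

theorem Wheel.arc_B (h : Wheel G U g k B D) {i j : ℕ} (h2 : j ≤ k + 1) :
    Disjoint (g '' Set.Ico i j) B := by
  rw [Set.disjoint_left]
  rintro _ ⟨a, ha, rfl⟩
  simp only [Set.mem_Ico] at ha
  exact h.gB a (by omega)

theorem Wheel.arc_U (h : Wheel G U g k B D) {i j : ℕ} (h2 : j ≤ k + 1) :
    g '' Set.Ico i j ⊆ U := by
  rintro _ ⟨a, ha, rfl⟩
  simp only [Set.mem_Ico] at ha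
  exact h.gU a (by omega)

theorem Wheel.arcs_touch (h : Wheel G U g k B D) {i j l : ℕ} (h1 : i < j) (h2 : j < l)
    (h3 : l ≤ k + 1) : Touch G (g '' Set.Ico i j) (g '' Set.Ico j l) := by
  refine ⟨g (j - 1), ⟨j - 1, ⟨by omega, by omega⟩, rfl⟩, g j, ⟨j, ⟨by omega, by omega⟩, rfl⟩, ?_⟩
  have := h.adj (j - 1) (by omega)
  rwa [show j - 1 + 1 = j by omega] at this

theorem Wheel.arcs_close (h : Wheel G U g k B D) {i j : ℕ} (h1 : 0 < i) (h2 : j < k + 1) :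
    Touch G (g '' Set.Ico 0 i) (g '' Set.Ico j (k + 1)) :=
  ⟨g 0, ⟨0, ⟨by omega, by omega⟩, rfl⟩, g k, ⟨k, ⟨by omega, by omega⟩, rfl⟩, h.close.symm⟩

/-- The index `i` of the rim is adjacent to `B`. -/
def At (G : SimpleGraph V) (g : ℕ → V) (B : Set V) (i : ℕ) : Prop := ∃ b ∈ B, G.Adj b (g i)

theorem At.touch {i a b : ℕ} (h : At G g B i) (h1 : a ≤ i) (h2 : i < b) :
    Touch G (g '' Set.Ico a b) B := by
  obtain ⟨x, hx, hxi⟩ := h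
  exact ⟨g i, ⟨i, ⟨h1, h2⟩, rfl⟩, x, hx, hxi.symm⟩

theorem Wheel.no_alt (h : Wheel G U g k B D) (hf : Free G U) {i j l m : ℕ} (hij : i < j)
    (hjl : j < l) (hlm : l < m) (hm : m ≤ k) (hi : At G g B i) (hj : At G g D j)
    (hl : At G g B l) (hm' : At G g D m) : False := by
  refine hf.2 (has_K33 ![g '' Set.Ico 0 j, g '' Set.Ico l m, D]
    ![g '' Set.Ico j l, g '' Set.Ico m (k + 1), B] ?_ ?_ ?_ ?_ ?_ ?_ ?_ ?_)
  · intro x; fin_cases x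
    · exact arc_conn h.adj (by omega) (by omega)
    · exact arc_conn h.adj (by omega) (by omega)
    · exact h.cD
  · intro x; fin_cases x
    · exact arc_conn h.adj (by omega) (by omega)
    · exact arc_conn h.adj (by omega) (by omega)
    · exact h.cB
  · have e1 := h.arcs_disj (i := 0) (j := j) (i' := l) (j' := m) (by omega) (by omega)
    have e2 := h.swap.arc_B (i := 0) (j := j) (by omega)
    have e3 := h.swap.arc_B (i := l) (j := m) (by omega)
    intro x y hxy
    fin_cases x <;> fin_cases y <;> first | exact absurd rfl hxy | assumption | (apply Disjoint.symm; assumption)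
  · have e1 := h.arcs_disj (i := j) (j := l) (i' := m) (j' := k + 1) (by omega) (by omega)
    have e2 := h.arc_B (i := j) (j := l) (by omega)
    have e3 := h.arc_B (i := m) (j := k + 1) (by omega)
    intro x y hxy
    fin_cases x <;> fin_cases y <;> first | exact absurd rfl hxy | assumption | (apply Disjoint.symm; assumption)
  · intro x y
    fin_cases x <;> fin_cases y
    · exact h.arcs_disj (by omega) (by omega)
    · exact h.arcs_disj (by omega) (by omega)
    · exact h.arc_B (by omega)
    · exact (h.arcs_disj (by omega) (by omega)).symm
    · exact h.arcs_disj (by omega) (by omega)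
    · exact h.arc_B (by omega)
    · exact (h.swap.arc_B (by omega)).symm
    · exact (h.swap.arc_B (by omega)).symm
    · exact h.dBD.symm
  · intro x y
    fin_cases x <;> fin_cases y
    · exact h.arcs_touch (by omega) (by omega) (by omega)
    · exact h.arcs_close (by omega) (by omega)
    · exact hi.touch (by omega) (by omega)
    · exact (h.arcs_touch (by omega) (by omega) (by omega)).symm
    · exact h.arcs_touch (by omega) (by omega) (by omega)
    · exact hl.touch (by omega) (by omega)
    · exact (hj.touch (by omega) (by omega)).symm
    · exact (hm'.touch (by omega) (by omega)).symm
    · exact h.tBD.symm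
  · intro x; fin_cases x
    · exact h.arc_U (by omega)
    · exact h.arc_U (by omega)
    · exact h.dU
  · intro x; fin_cases x
    · exact h.arc_U (by omega)
    · exact h.arc_U (by omega)
    · exact h.bU

theorem Wheel.no_three (h : Wheel G U g k B D) (hf : Free G U) {i j l : ℕ} (hij : i < j)
    (hjl : j < l) (hl : l ≤ k) (hi : At G g B i) (hj : At G g B j) (hl' : At G g B l)
    (di : At G g D i) (dj : At G g D j) (dl : At G g D l) : False := by
  refine hf.1 (has_K5 ![g '' Set.Ico 0 j, g '' Set.Ico j l, g '' Set.Ico l (k + 1), B, D] ?_ ?_ ?_)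
  · intro x; fin_cases x
    · exact arc_conn h.adj (by omega) (by omega)
    · exact arc_conn h.adj (by omega) (by omega)
    · exact arc_conn h.adj (by omega) (by omega)
    · exact h.cB
    · exact h.cD
  · intro x y hxy
    fin_cases x <;> fin_cases y <;> first | exact absurd hxy (by decide) | skip
    · exact ⟨h.arcs_disj (by omega) (by omega), h.arcs_touch (by omega) (by omega) (by omega)⟩
    · exact ⟨h.arcs_disj (by omega) (by omega), h.arcs_close (by omega) (by omega)⟩
    · exact ⟨h.arc_B (by omega), hi.touch (by omega) (by omega)⟩
    · exact ⟨h.swap.arc_B (by omega), di.touch (by omega) (by omega)⟩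
    · exact ⟨h.arcs_disj (by omega) (by omega), h.arcs_touch (by omega) (by omega) (by omega)⟩
    · exact ⟨h.arc_B (by omega), hj.touch (by omega) (by omega)⟩
    · exact ⟨h.swap.arc_B (by omega), dj.touch (by omega) (by omega)⟩
    · exact ⟨h.arc_B (by omega), hl'.touch (by omega) (by omega)⟩
    · exact ⟨h.swap.arc_B (by omega), dl.touch (by omega) (by omega)⟩
    · exact ⟨h.dBD, h.tBD⟩
  · intro x; fin_cases x
    · exact h.arc_U (by omega)
    · exact h.arc_U (by omega)
    · exact h.arc_U (by omega)
    · exact h.bU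
    · exact h.dU

/-- The combinatorial core of the segment lemma. -/
theorem segment_idx (A Z : ℕ → Prop) (k : ℕ)
    (H1 : ∀ i j l m, i < j → j < l → l < m → m ≤ k → A i → Z j → A l → Z m → False)
    (H2 : ∀ i j l m, i < j → j < l → l < m → m ≤ k → Z i → A j → Z l → A m → False)
    (H3 : ∀ i j l, i < j → j < l → l ≤ k → A i → A j → A l → Z i → Z j → Z l → False)
    (h0 : Z 0) (hA : ∃ i j, i < j ∧ j ≤ k ∧ A i ∧ A j) :
    ∃ p q, p < q ∧ q ≤ k + 1 ∧ A p ∧ (q ≤ k ∧ A q ∨ q = k + 1 ∧ A 0 ∧ 0 < p) ∧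
      (∀ z ≤ k, Z z → z ≤ p ∨ q ≤ z) ∧
      (∀ x ≤ k, A x → (p ≤ x ∧ x ≤ q) ∨ (x = 0 ∧ q = k + 1)) := by
  classical
  obtain ⟨i, j, hij, hjk, hi, hj⟩ := hA
  -- the largest element of `A`
  obtain ⟨m, hm, hmA, hmax⟩ : ∃ m, m ≤ k ∧ A m ∧ ∀ x ≤ k, A x → x ≤ m := by
    have := Nat.findGreatest_spec (P := A) hjk hj
    exact ⟨_, Nat.findGreatest_le k, this, fun x hx hAx => Nat.le_findGreatest hx hAx⟩
  obtain ⟨m1, hm1, hm1A, hmin⟩ : ∃ m, 0 < m ∧ A m ∧ ∀ x, 0 < x → A x → m ≤ x := by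
    have h : ∃ x, 0 < x ∧ A x := ⟨j, by omega, hj⟩
    have := Nat.find_spec h
    exact ⟨_, this.1, this.2, fun x hx hAx => Nat.find_min' h ⟨hx, hAx⟩⟩
  have hjm := hmax j hjk hj
  have hm1j := hmin j (by omega) hj
  by_cases hA0 : A 0
  · by_cases c1 : ∀ z ≤ k, Z z → z ≤ 0 ∨ m ≤ z
    · exact ⟨0, m, by omega, by omega, hA0, Or.inl ⟨hm, hmA⟩, c1,
        fun x hx hAx => Or.inl ⟨by omega, hmax x hx hAx⟩⟩
    by_cases c2 : ∀ z ≤ k, Z z → z ≤ m1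
    · refine ⟨m1, k + 1, by omega, le_rfl, hm1A, Or.inr ⟨rfl, hA0, hm1⟩,
        fun z hz hZ => Or.inl (c2 z hz hZ), fun x hx hAx => ?_⟩
      rcases Nat.eq_zero_or_pos x with h | h
      · exact Or.inr ⟨h, rfl⟩
      · exact Or.inl ⟨hmin x h hAx, by omega⟩
    exfalso
    push Not at c1 c2
    obtain ⟨z, hz, hZ, hz0, hzm⟩ := c1
    obtain ⟨z', hz', hZ', hzm'⟩ := c2
    rcases lt_trichotomy z' m with h | h | h
    · exact H2 0 m1 z' m hm1 hzm' h hm h0 hm1A hZ' hmA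
    · subst h
      rcases lt_trichotomy z m1 with h | h | h
      · exact H1 0 z m1 z' hz0 h hzm' hm hA0 hZ hm1A hZ'
      · subst h
        exact H3 0 z z' hz0 hzm hm hA0 hm1A hmA h0 hZ hZ'
      · exact H2 0 m1 z z' hm1 h hzm hm h0 hm1A hZ hmA
    · exact H1 0 z m z' hz0 hzm h hz' hA0 hZ hmA hZ'
  · have hi0 : 0 < i := Nat.pos_of_ne_zero (by rintro rfl; exact hA0 hi)
    have := hmin i hi0 hi
    refine ⟨m1, m, by omega, by omega, hm1A, Or.inl ⟨hm, hmA⟩, fun z hz hZ => ?_,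
      fun x hx hAx => Or.inl ⟨?_, hmax x hx hAx⟩⟩
    · by_contra hcon
      push Not at hcon
      exact H2 0 m1 z m hm1 hcon.1 hcon.2 hm h0 hm1A hZ hmA
    · exact hmin x (Nat.pos_of_ne_zero (by rintro rfl; exact hA0 hAx)) hAx

theorem Wheel.segment (h : Wheel G U g k B D) (hf : Free G U) (h0 : At G g D 0)
    (hA : ∃ i j, i < j ∧ j ≤ k ∧ At G g B i ∧ At G g B j) :
    ∃ p q, p < q ∧ q ≤ k + 1 ∧ At G g B p ∧
      (q ≤ k ∧ At G g B q ∨ q = k + 1 ∧ At G g B 0 ∧ 0 < p) ∧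
      (∀ z ≤ k, At G g D z → z ≤ p ∨ q ≤ z) ∧
      (∀ x ≤ k, At G g B x → (p ≤ x ∧ x ≤ q) ∨ (x = 0 ∧ q = k + 1)) := by
  refine segment_idx _ _ k ?_ ?_ ?_ h0 hA
  · intro i j l m h1 h2 h3 h4 a1 a2 a3 a4
    exact h.no_alt hf h1 h2 h3 h4 a1 a2 a3 a4
  · intro i j l m h1 h2 h3 h4 a1 a2 a3 a4
    exact h.swap.no_alt hf h1 h2 h3 h4 a1 a2 a3 a4
  · intro i j l h1 h2 h3 a1 a2 a3 d1 d2 d3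
    exact h.no_three hf h1 h2 h3 a1 a2 a3 d1 d2 d3

end GM

namespace GM
variable {V : Type} {G : SimpleGraph V} {U B D : Set V}

theorem segment_list {s : V} {c : List V} (hnd : (s :: c).Nodup)
    (hch : List.IsChain G.Adj (s :: c ++ [s])) (hc : c ≠ [])
    (cB : Conn G B) (cD : Conn G D) (dBD : Disjoint B D) (tBD : Touch G B D)
    (gB : ∀ x ∈ s :: c, x ∉ B) (gD : ∀ x ∈ s :: c, x ∉ D) (gU : ∀ x ∈ s :: c, x ∈ U)
    (bU : B ⊆ U) (dU : D ⊆ U) (hf : Free G U) (hs : ∃ d ∈ D, G.Adj d s)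
    {u v : V} (huv : u ≠ v) (hu : u ∈ s :: c) (hv : v ∈ s :: c) (hub : ∃ b ∈ B, G.Adj b u)
    (hvb : ∃ b ∈ B, G.Adj b v) :
    ∃ X M Y α δ : List V, ∃ a e : V, c = X ++ M ++ Y ∧ s :: X = α ++ [a] ∧ Y ++ [s] = e :: δ ∧
      a ≠ e ∧ (∃ b ∈ B, G.Adj b a) ∧ (∃ b ∈ B, G.Adj b e) ∧
      (∀ x ∈ M, ∀ d ∈ D, ¬ G.Adj d x) ∧
      ∀ x ∈ s :: c, ∀ b ∈ B, G.Adj b x → x = a ∨ x = e ∨ x ∈ M := by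
  set L := s :: c ++ [s] with hL
  set k := c.length with hk
  have hkpos : 0 < k := List.length_pos_iff.2 hc
  have hLl : L.length = k + 2 := by simp [hL, hk]
  let g : ℕ → V := fun i => L.getD i s
  have gL : ∀ i (h : i < L.length), g i = L[i] := fun i h => by
    simp only [g, List.getD_eq_getElem?_getD, List.getElem?_eq_getElem h, Option.getD_some]
  have gc : ∀ i (h : i ≤ k), g i = (s :: c)[i]'(by simp; omega) := fun i h => by
    rw [gL i (by omega)]
    simp only [hL]
    rw [List.getElem_append_left]
  have gmem : ∀ i ≤ k, g i ∈ s :: c := fun i h => by rw [gc i h]; exact List.getElem_mem _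
  have gex : ∀ x ∈ s :: c, ∃ i ≤ k, g i = x := by
    intro x hx
    obtain ⟨i, hi, rfl⟩ := List.getElem_of_mem hx
    have : i ≤ k := by simp at hi; omega
    exact ⟨i, this, gc i this⟩
  have g0 : g 0 = s := by rw [gc 0 (by omega)]; rfl
  have gk : g (k + 1) = s := by
    rw [gL _ (by omega)]; simp [hL, hk]
  have gadj : ∀ i < k + 1, G.Adj (g i) (g (i + 1)) := by
    intro i hi
    rw [gL i (by omega), gL (i + 1) (by omega)]
    exact List.isChain_iff_getElem.1 hch i (by omega)
  have hw : Wheel G U g k B D := by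
    refine ⟨?_, fun i hi => gadj i (by omega), ?_, cB, cD, dBD, tBD, fun i hi => gB _ (gmem i hi),
      fun i hi => gD _ (gmem i hi), fun i hi => gU _ (gmem i hi), bU, dU⟩
    · intro i hi j hj hij
      rw [gc i hi, gc j hj] at hij
      exact (List.Nodup.getElem_inj_iff hnd).1 hij
    · have := gadj k (by omega)
      rwa [gk, ← g0] at this
  have hA : ∃ i j, i < j ∧ j ≤ k ∧ At G g B i ∧ At G g B j := by
    obtain ⟨i, hi, rfl⟩ := gex u hu
    obtain ⟨j, hj, rfl⟩ := gex v hv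
    rcases lt_trichotomy i j with h | h | h
    · exact ⟨i, j, h, hj, hub, hvb⟩
    · exact absurd (by rw [h]) huv
    · exact ⟨j, i, h, hi, hvb, hub⟩
  obtain ⟨p, q, hpq, hqk, hAp, hAq, hZ, hAx⟩ := hw.segment hf (by rw [At, g0]; exact hs) hA
  refine ⟨c.take p, (c.drop p).take (q - 1 - p), c.drop (q - 1), (s :: c).take p, L.drop (q + 1),
    g p, g q, ?_, ?_, ?_, ?_, hAp, ?_, ?_, ?_⟩
  · have h1 := List.take_append_drop (q - 1 - p) (c.drop p)
    rw [List.drop_drop, show p + (q - 1 - p) = q - 1 by omega] at h1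
    rw [List.append_assoc, h1, List.take_append_drop]
  · rw [gc p (by omega)]
    rw [show s :: List.take p c = (s :: c).take (p + 1) by simp]
    rw [List.take_succ_eq_append_getElem]
  · rw [gL q (by omega), ← List.drop_eq_getElem_cons]
    rw [hL]
    obtain ⟨q', rfl⟩ : ∃ q', q = q' + 1 := ⟨q - 1, by omega⟩
    simp only [List.cons_append, List.drop_succ_cons, Nat.add_sub_cancel]
    rw [List.drop_append_of_le_length (by omega)]
  · intro h
    rcases hAq with ⟨h1, _⟩ | ⟨h1, _, h3⟩
    · have := hw.inj p (by omega) q h1 h; omega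
    · rw [h1, gk, ← g0] at h
      have := hw.inj p (by omega) 0 (by omega) h; omega
  · rcases hAq with ⟨h1, h2⟩ | ⟨h1, h2, h3⟩
    · exact h2
    · rw [h1, gk, ← g0]; exact h2
  · intro x hx d hd hdx
    obtain ⟨i, hi, rfl⟩ := List.getElem_of_mem hx
    have hi' : i < q - 1 - p := by simp at hi; omega
    have e : g (p + 1 + i) = ((c.drop p).take (q - 1 - p))[i] := by
      rw [gc _ (by omega)]
      simp [show p + 1 + i = (p + i) + 1 by omega]
    rw [← e] at hdx
    have := hZ (p + 1 + i) (by omega) ⟨d, hd, hdx⟩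
    omega
  · intro x hx b hb hbx
    obtain ⟨i, hi, rfl⟩ := gex x hx
    rcases hAx i hi ⟨b, hb, hbx⟩ with ⟨h1, h2⟩ | ⟨h1, h2⟩
    · rcases h1.eq_or_lt with h | h
      · left; rw [h]
      · rcases h2.eq_or_lt with h' | h'
        · right; left; rw [h']
        · right; right
          rw [gc i hi]
          rw [List.mem_iff_getElem]
          refine ⟨i - 1 - p, by simp; omega, ?_⟩
          obtain ⟨i', rfl⟩ : ∃ i', i = i' + 1 := ⟨i - 1, by omega⟩
          simp only [List.getElem_take, List.getElem_drop, List.getElem_cons_succ]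
          congr 1; omega
    · right; left; rw [h1, h2, g0, gk]

end GM

namespace GM
variable {V : Type} {G : SimpleGraph V} {U B D : Set V}

/-- Neighbourhood of `K` in `U`. -/
def nb (G : SimpleGraph V) (U K : Set V) : Set V := {v | v ∈ U ∧ v ∉ K ∧ ∃ k ∈ K, G.Adj k v}

/-- No connected set away from `x`, `y` is cut off by at most two vertices. -/
def NoCut (G : SimpleGraph V) (U : Set V) (x y : V) : Prop :=
  ∀ K ⊆ U, x ∉ K → y ∉ K → Conn G K → (∃ w ∈ U, w ∉ K ∧ w ∉ nb G U K) → 3 ≤ (nb G U K).ncard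

theorem pigeon {x1 x2 x3 y1 y2 y3 : Prop} (a1 : x1 ∨ x2) (a2 : x1 ∨ x3) (a3 : x2 ∨ x3)
    (b1 : y1 ∨ y2) (b2 : y1 ∨ y3) (b3 : y2 ∨ y3) (c1 : x1 → y1 → False) (c2 : x2 → y2 → False)
    (c3 : x3 → y3 → False) : False := by
  grind

set_option maxHeartbeats 1000000 in
theorem all_adj [Finite V] {C : Set V} {z0 s : V} (hBD : B ⊆ D) (hDU : D ⊆ U) (hz : z0 ∈ D)
    (hzB : z0 ∉ B) (hs : s ∉ D) (cB : Conn G B) (cD : Conn G (D \ B)) (tBD : Touch G B (D \ B))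
    (hND : ∀ d ∈ D, ∀ v ∈ U, v ∉ D → G.Adj d v → v ∈ C) (hCD : ∀ v ∈ C, v ∉ D)
    (hcut : NoCut G U z0 s)
    (hmin : ∀ Q ⊆ B, Q ≠ B → Conn G Q → Conn G (D \ Q) → ∀ u ∈ C, ∀ v ∈ C,
      (∃ q ∈ Q, G.Adj q u) → (∃ q ∈ Q, G.Adj q v) → u = v)
    {u v : V} (hu : u ∈ C) (hv : v ∈ C) (huv : u ≠ v) (hBu : ∃ b ∈ B, G.Adj b u)
    (hBv : ∃ b ∈ B, G.Adj b v) : ∀ b ∈ B, ∃ d ∈ D \ B, G.Adj b d := by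
  intro x hxB
  by_contra hx
  set S : Set V := {b | b ∈ B ∧ ∃ d ∈ D \ B, G.Adj b d} with hS
  have hxS : x ∈ B \ S := ⟨hxB, fun h => hx h.2⟩
  set X := comp G (B \ S) x with hX
  have hXsub : X ⊆ B \ S := comp_sub hxS
  have hXconn : Conn G X := comp_conn x
  have hxX : x ∈ X := mem_comp x
  have hNX : ∀ w ∈ nb G U X, w ∈ S ∨ w ∈ C := by
    rintro w ⟨hwU, hwX, k, hk, hkw⟩
    have hkBS := hXsub hk
    by_cases hwD : w ∈ D
    · left
      by_cases hwB : w ∈ B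
      · by_contra hwS
        exact hwX (comp_closed hxS hk ⟨hwB, hwS⟩ hkw)
      · exact absurd ⟨hkBS.1, w, ⟨hwD, hwB⟩, hkw⟩ hkBS.2
    · right
      exact hND k (hBD hkBS.1) w hwU hwD hkw
  have hcard : 3 ≤ (nb G U X).ncard := by
    refine hcut X ?_ ?_ ?_ hXconn ⟨z0, hDU hz, ?_, ?_⟩
    · exact fun y hy => hDU (hBD (hXsub hy).1)
    · exact fun h => hzB (hXsub h).1
    · exact fun h => hs (hBD (hXsub h).1)
    · exact fun h => hzB (hXsub h).1
    · intro h
      rcases hNX z0 h with h | h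
      · exact hzB h.1
      · exact hCD _ h hz
  -- the big pieces
  let Q : V → Set V := fun p => comp G (B \ {p}) x
  have hxp : ∀ p ∈ S, x ∈ B \ {p} := fun p hp => ⟨hxB, by rintro rfl; exact hx hp.2⟩
  have hXQ : ∀ p ∈ S, X ⊆ Q p := fun p hp =>
    hXconn.sub_comp (S := B \ {p}) (fun y hy => ⟨(hXsub hy).1, by rintro rfl; exact (hXsub hy).2 hp⟩) hxX
  have hQB : ∀ p ∈ S, Q p ⊆ B \ {p} := fun p hp => comp_sub (hxp p hp)
  have hreach : ∀ p ∈ S, ∀ y ∈ B, y ∉ Q p → Reach G (B \ Q p) y p := by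
    intro p hp y hy hyQ
    refine cB.reach_avoid hp.1 ?_ (fun h => (hQB p hp h).2 rfl) hy hyQ
    intro a ha b hb hbp hab
    exact comp_closed (hxp p hp) ha ⟨hb, hbp⟩ hab
  have hone : ∀ p ∈ S, ∀ u ∈ C, ∀ v ∈ C,
      (∃ q ∈ Q p, G.Adj q u) → (∃ q ∈ Q p, G.Adj q v) → u = v := by
    intro p hp
    refine hmin (Q p) (fun y hy => (hQB p hp hy).1) ?_ (comp_conn x) ?_
    · intro h
      have : p ∈ Q p := by rw [h]; exact hp.1
      exact (hQB p hp this).2 rfl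
    · refine cD.extend (fun y hy => ⟨hy.1, fun h => hy.2 (hQB p hp h).1⟩) ?_
      rintro y ⟨hyD, hyQ⟩
      by_cases hyB : y ∈ B
      · obtain ⟨d, hd, hpd⟩ := hp.2
        refine ⟨d, hd, ?_⟩
        refine ((hreach p hp y hyB hyQ).mono le_rfl ?_).trans (Reach.one hpd ?_ ?_)
        · exact fun z hz => ⟨hBD hz.1, hz.2⟩
        · exact ⟨hBD hp.1, fun h => (hQB p hp h).2 rfl⟩
        · exact ⟨hd.1, fun h => hd.2 (hQB p hp h).1⟩
      · exact ⟨y, ⟨hyD, hyB⟩, .refl⟩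
  have hcover : ∀ p ∈ S, p ∈ nb G U X → ∀ p' ∈ S, p' ∈ nb G U X → p ≠ p' → ∀ y ∈ B,
      y ∈ Q p ∨ y ∈ Q p' := by
    intro p hp hpX p' hp' hpX' hne y hy
    by_contra hcon
    push Not at hcon
    have hin : ∀ p ∈ S, ∀ p' ∈ S, p' ∈ nb G U X → p ≠ p' → p' ∈ Q p := by
      intro p hp p' hp' hpX' hne
      obtain ⟨_, _, k, hk, hkp⟩ := hpX'
      exact comp_closed (hxp p hp) (hXQ p hp hk) ⟨hp'.1, fun h => hne h.symm⟩ hkp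
    have h1 := hin p hp p' hp' hpX' hne
    have h2 := hin p' hp' p hp hpX hne.symm
    have h3 := (hreach p hp y hy hcon.1).mono (G' := G) (T := B \ {p'}) le_rfl
      (fun z hz => ⟨hz.1, by rintro rfl; exact hz.2 h1⟩)
    exact hcon.2 (Relation.ReflTransGen.trans h2 h3.symm)
  have hcov' : ∀ p ∈ S, p ∈ nb G U X → ∀ p' ∈ S, p' ∈ nb G U X → p ≠ p' → ∀ w,
      (∃ b ∈ B, G.Adj b w) → (∃ q ∈ Q p, G.Adj q w) ∨ (∃ q ∈ Q p', G.Adj q w) := by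
    rintro p hp hpX p' hp' hpX' hne w ⟨b, hb, hbw⟩
    rcases hcover p hp hpX p' hp' hpX' hne b hb with h | h
    · exact Or.inl ⟨b, h, hbw⟩
    · exact Or.inr ⟨b, h, hbw⟩
  have hXw : ∀ p ∈ S, ∀ w ∈ nb G U X, ∃ q ∈ Q p, G.Adj q w := by
    rintro p hp w ⟨_, _, k, hk, hkw⟩
    exact ⟨k, hXQ p hp hk, hkw⟩
  have r1 : ∀ w ∈ nb G U X, ∀ w' ∈ nb G U X, w ∈ C → w' ∈ C → w = w' := by
    intro w hw w' hw' hwC hwC'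
    obtain ⟨p, hpB, d, hd, hpd⟩ := tBD
    have hpS : p ∈ S := ⟨hpB, d, hd, hpd⟩
    exact hone p hpS w hwC w' hwC' (hXw p hpS w hw) (hXw p hpS w' hw')
  have r2 : ∀ p ∈ nb G U X, ∀ p' ∈ nb G U X, ∀ w ∈ nb G U X, p ∈ S → p' ∈ S → w ∈ C → p = p' := by
    intro p hp p' hp' w hw hpS hpS' hwC
    by_contra hne
    have hu2 := hcov' p hpS hp p' hpS' hp' hne u hBu
    have hv2 := hcov' p hpS hp p' hpS' hp' hne v hBv
    have eu : w = u := by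
      rcases hu2 with h | h
      · exact hone p hpS w hwC u hu (hXw p hpS w hw) h
      · exact hone p' hpS' w hwC u hu (hXw p' hpS' w hw) h
    have ev : w = v := by
      rcases hv2 with h | h
      · exact hone p hpS w hwC v hv (hXw p hpS w hw) h
      · exact hone p' hpS' w hwC v hv (hXw p' hpS' w hw) h
    exact huv (eu.symm.trans ev)
  obtain ⟨p1, p2, p3, h1, h2, h3, n12, n13, n23⟩ := (Set.two_lt_ncard_iff (Set.toFinite _)).1 hcard
  rcases hNX p1 h1 with s1 | c1 <;> rcases hNX p2 h2 with s2 | c2 <;> rcases hNX p3 h3 with s3 | c3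
  · have no : ∀ p ∈ S, (∃ q ∈ Q p, G.Adj q u) → (∃ q ∈ Q p, G.Adj q v) → False :=
      fun p hp a b => huv (hone p hp u hu v hv a b)
    have a1 := hcov' p1 s1 h1 p2 s2 h2 n12 u hBu
    have a2 := hcov' p1 s1 h1 p3 s3 h3 n13 u hBu
    have a3 := hcov' p2 s2 h2 p3 s3 h3 n23 u hBu
    have b1 := hcov' p1 s1 h1 p2 s2 h2 n12 v hBv
    have b2 := hcov' p1 s1 h1 p3 s3 h3 n13 v hBv
    have b3 := hcov' p2 s2 h2 p3 s3 h3 n23 v hBv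
    have c1 := no p1 s1
    have c2 := no p2 s2
    have c3 := no p3 s3
    exact pigeon a1 a2 a3 b1 b2 b3 c1 c2 c3
  · exact n12 (r2 _ h1 _ h2 _ h3 s1 s2 c3)
  · exact n13 (r2 _ h1 _ h3 _ h2 s1 s3 c2)
  · exact n23 (r1 _ h2 _ h3 c2 c3)
  · exact n23 (r2 _ h2 _ h3 _ h1 s2 s3 c1)
  · exact n13 (r1 _ h1 _ h3 c1 c3)
  · exact n12 (r1 _ h1 _ h2 c1 c2)
  · exact n12 (r1 _ h1 _ h2 c1 c2)

/-- The pair `u`, `v` is seen in one of the two orders. -/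
def Seen (P : Set (V × V)) (u v : V) : Prop := (u, v) ∈ P ∨ (v, u) ∈ P

theorem Seen.symm {P : Set (V × V)} {u v : V} (h : Seen P u v) : Seen P v u := Or.symm h

theorem Seen.mono {P P' : Set (V × V)} {u v : V} (hP : P ⊆ P') (h : Seen P u v) : Seen P' u v :=
  h.imp (fun h => hP h) (fun h => hP h)

theorem Run.cast {w w' : List V} {I I' : Set V} {P P' : Set (V × V)} {t t' : ℕ}
    (h : Run w I P t w') (hI : I = I') (hP : P = P') (ht : t = t') : Run w I' P' t' w' := by
  subst hI hP ht; exact h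

theorem Run.delAll (α : List V) (b : V) (M δ : List V) :
    Run (α ++ b :: (M ++ δ)) ∅ {p | p.1 = b ∧ p.2 ∈ M} M.length (α ++ b :: δ) := by
  induction M with
  | nil => exact (Run.nil _).cast rfl (by ext; simp) rfl
  | cons m M ih =>
    refine (((Run.see α b m (M ++ δ)).trans (Run.del α b m (M ++ δ)) (by simp)).trans ih
      (by simp)).cast (by simp) ?_ (by simp; omega)
    ext ⟨p, q⟩
    simp
    tauto

theorem peel_step {a e b y : V} (cB : Conn G B) (hb : b ∈ B) (hy : y ∈ B) (hyb : y ≠ b)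
    (hye : G.Adj y e) (hba : G.Adj b a)
    (hmin : ∀ Q ⊆ B, Q ≠ B → Conn G Q → (∃ q ∈ Q, G.Adj q a) → (∃ q ∈ Q, G.Adj q e) → False) :
    Conn G (B \ {b}) := by
  have hyB : y ∈ B \ {b} := ⟨hy, hyb⟩
  set Q := comp G (B \ {b}) y with hQ
  have hQs : Q ⊆ B \ {b} := comp_sub hyB
  obtain ⟨u, _, huQ, v, hvB, hvQ, huv⟩ := cB.exists_edge (A := Q) hy (mem_comp y) hb
    (fun h => (hQs h).2 rfl)
  have hvb : v = b := by
    by_contra h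
    exact hvQ (comp_closed hyB huQ ⟨hvB, h⟩ huv)
  subst hvb
  have hc : Conn G (Q ∪ {v}) := (comp_conn y).union (Conn.singleton v) ⟨u, huQ, v, rfl, Or.inr huv⟩
  have heq : Q ∪ {v} = B := by
    by_contra hne
    refine hmin _ ?_ hne hc ⟨v, Or.inr rfl, hba⟩ ⟨y, Or.inl (mem_comp y), hye⟩
    rintro z (hz | rfl)
    · exact (hQs hz).1
    · exact hb
  have : B \ {v} = Q := by
    apply Set.Subset.antisymm _ hQs
    rintro z ⟨hz, hzv⟩
    rw [← heq] at hz
    rcases hz with hz | hz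
    · exact hz
    · exact absurd hz hzv
  rw [this]
  exact comp_conn y

theorem peel [Finite V] {e : V} : ∀ (n : ℕ) (B : Set V) (a : V) (M : List V), B.ncard = n →
    Conn G B → (∃ b ∈ B, G.Adj b a) → (∃ b ∈ B, G.Adj b e) →
    (∀ Q ⊆ B, Q ≠ B → Conn G Q → (∃ q ∈ Q, G.Adj q a) → (∃ q ∈ Q, G.Adj q e) → False) →
    ∃ (β : List V) (P : Set (V × V)),
      Run (a :: (M ++ [e])) B P (B.ncard + M.length) (a :: (β ++ [e])) ∧ β.Nodup ∧
      (∀ x, x ∈ β ↔ x ∈ B) ∧ List.IsChain G.Adj (a :: (β ++ [e])) ∧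
      (∀ b ∈ B, ∀ b' ∈ B, G.Adj b b' → Seen P b b') ∧
      (∀ b ∈ B, G.Adj b a → Seen P b a ∧ ∀ m ∈ M, Seen P b m) ∧
      ∀ b ∈ B, G.Adj b e → Seen P b e := by
  intro n
  induction n with
  | zero =>
    intro B a M hn hB
    rw [Set.ncard_eq_zero (Set.toFinite _)] at hn
    exact absurd hB.1 (by simp [hn])
  | succ n ih =>
    intro B a M hn cB ha he hmin
    obtain ⟨b, hb, hba⟩ := ha
    have run1 : Run (a :: (M ++ [e])) {b} {p | (p = (a, b)) ∨ (p.1 = b ∧ p.2 ∈ M) ∨ p = (b, e)}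
        (1 + M.length) (a :: b :: [e]) := by
      refine ((((Run.ins [] a b (M ++ [e])).trans (Run.see [] a b (M ++ [e])) (by simp)).trans
        (Run.delAll [a] b M [e]) (by simp)).trans (Run.see [a] b e []) (by simp)).cast
        (by simp) ?_ (by simp)
      ext ⟨p, q⟩
      simp
      tauto
    by_cases hbe : G.Adj b e
    · have hBb : B = {b} := by
        by_contra hne
        exact hmin {b} (by simpa using hb) (fun h => hne h.symm) (Conn.singleton b)
          ⟨b, rfl, hba⟩ ⟨b, rfl, hbe⟩
      subst hBb
      refine ⟨[b], _, run1.cast rfl rfl (by simp), by simp, by simp, ?_, ?_, ?_, ?_⟩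
      · simp [hba.symm, hbe]
      · rintro _ rfl _ rfl h
        exact absurd h (G.loopless.irrefl _)
      · rintro _ rfl _
        exact ⟨Or.inr (by simp), fun m hm => Or.inl (by simp [hm])⟩
      · rintro _ rfl _
        exact Or.inl (by simp)
    · obtain ⟨y, hy, hye⟩ := he
      have hyb : y ≠ b := by rintro rfl; exact hbe hye
      have cQ := peel_step cB hb hy hyb hye hba hmin
      have hQB : B \ {b} ≠ B := fun h => by
        have : b ∈ B \ {b} := by rw [h]; exact hb
        exact this.2 rfl
      have hQn : (B \ {b}).ncard = n := by rw [Set.ncard_sdiff_singleton_of_mem hb]; omega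
      have hbQ : ∃ q ∈ B \ {b}, G.Adj q b := by
        obtain ⟨u, _, hu, v, hv, hvQ, huv⟩ := cB.exists_edge (A := B \ {b}) hy ⟨hy, hyb⟩ hb
          (by simp)
        have : v = b := by
          by_contra h
          exact hvQ ⟨hv, h⟩
        subst this
        exact ⟨u, hu, huv⟩
      have hQa : ∀ q ∈ B \ {b}, ¬ G.Adj q a := fun q hq hqa =>
        hmin _ Set.sdiff_subset hQB cQ ⟨q, hq, hqa⟩ ⟨y, ⟨hy, hyb⟩, hye⟩
      obtain ⟨β, P, hrun, hnd, hmem, hch, hin, hfa, hfe⟩ := ih (B \ {b}) b [] hQn cQ hbQ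
        ⟨y, ⟨hy, hyb⟩, hye⟩ (by
          intro Q hQ hne cQ' hqb hqe
          obtain ⟨q, hq, hqb⟩ := hqb
          obtain ⟨q', hq', hqe⟩ := hqe
          refine hmin (Q ∪ {b}) ?_ ?_ (cQ'.union (Conn.singleton b) ⟨q, hq, b, rfl, Or.inr hqb⟩)
            ⟨b, Or.inr rfl, hba⟩ ⟨q', Or.inl hq', hqe⟩
          · rintro z (hz | rfl)
            · exact (hQ hz).1
            · exact hb
          · intro h
            apply hne
            apply Set.Subset.antisymm hQ
            rintro z ⟨hz, hzb⟩
            rw [← h] at hz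
            exact hz.resolve_right hzb)
      have run2 := run1.trans (by simpa using hrun.context [a] []) (by simp)
      refine ⟨b :: β, _, run2.cast ?_ rfl ?_, ?_, ?_, ?_, ?_, ?_, ?_⟩
      · ext z; simp only [Set.mem_union, Set.mem_singleton_iff, Set.mem_sdiff]
        constructor
        · rintro (rfl | h)
          · exact hb
          · exact h.1
        · intro h; by_cases hz : z = b
          · exact Or.inl hz
          · exact Or.inr ⟨h, hz⟩
      · simp only [hQn, hn, List.length_nil]
        omega
      · rw [List.nodup_cons]
        exact ⟨fun h => ((hmem b).1 h).2 rfl, hnd⟩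
      · intro x
        simp only [List.mem_cons, hmem, Set.mem_sdiff, Set.mem_singleton_iff]
        constructor
        · rintro (rfl | h)
          · exact hb
          · exact h.1
        · intro h; by_cases hz : x = b
          · exact Or.inl hz
          · exact Or.inr ⟨h, hz⟩
      · rw [List.cons_append, List.isChain_cons_cons]
        exact ⟨hba.symm, hch⟩
      · intro x hx y hy hxy
        by_cases hxb : x = b
        · subst hxb
          by_cases hyx : y = x
          · subst hyx; exact absurd hxy (G.loopless.irrefl _)
          · exact ((hfa y ⟨hy, hyx⟩ hxy.symm).1.mono Set.subset_union_right).symm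
        · by_cases hyb : y = b
          · subst hyb
            exact (hfa x ⟨hx, hxb⟩ hxy).1.mono Set.subset_union_right
          · exact (hin x ⟨hx, hxb⟩ y ⟨hy, hyb⟩ hxy).mono Set.subset_union_right
      · intro x hx hxa
        have hxb : x = b := by
          by_contra h
          exact hQa x ⟨hx, h⟩ hxa
        subst hxb
        exact ⟨Or.inr (by simp), fun m hm => Or.inl (by simp [hm])⟩
      · intro x hx hxe
        by_cases hxb : x = b
        · subst hxb; exact absurd hxe hbe
        · exact (hfe x ⟨hx, hxb⟩ hxe).mono Set.subset_union_right

end GM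

namespace GM
variable {V : Type} {G : SimpleGraph V} {U B D : Set V}

theorem exists_min_set [Finite V] (p : Set V → Prop) (h : ∃ B, p B) :
    ∃ B, p B ∧ ∀ Q ⊆ B, Q ≠ B → ¬ p Q := by
  classical
  have h' : ∃ n, ∃ B, p B ∧ B.ncard = n := by
    obtain ⟨B, hB⟩ := h
    exact ⟨_, B, hB, rfl⟩
  obtain ⟨B, hB, hn⟩ := Nat.find_spec h'
  refine ⟨B, hB, fun Q hQ hne hp => hne ?_⟩
  refine Set.eq_of_subset_of_ncard_le hQ ?_ (Set.toFinite _)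
  rw [hn]
  exact Nat.find_min' h' ⟨Q, hp, rfl⟩

/-- The first candidate for the next piece to be swept. -/
theorem exists_piece [Finite V] {z0 s y : V} {C : Set V} (hcut : NoCut G U z0 s)
    (cD : Conn G D) (hz : z0 ∈ D) (hDU : D ⊆ U) (hy : y ∈ D) (hyz : y ≠ z0)
    (hCD : ∀ x ∈ C, x ∉ D) (hCU : C ⊆ U) (hsC : s ∈ C)
    (hND : ∀ d ∈ D, ∀ v ∈ U, v ∉ D → G.Adj d v → v ∈ C) {r : V} (hr : r ∈ C) (hrs : s ≠ r) :
    ∃ B, B ⊆ D ∧ z0 ∉ B ∧ Conn G B ∧ Conn G (D \ B) ∧ ∃ u ∈ C, ∃ v ∈ C, u ≠ v ∧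
      (∃ b ∈ B, G.Adj b u) ∧ (∃ b ∈ B, G.Adj b v) := by
  have hyD : y ∈ D \ {z0} := ⟨hy, hyz⟩
  set B := comp G (D \ {z0}) y with hB
  have hBs : B ⊆ D \ {z0} := comp_sub hyD
  refine ⟨B, fun x hx => (hBs hx).1, fun h => (hBs h).2 rfl, comp_conn y, ?_, ?_⟩
  · refine (Conn.singleton z0).extend ?_ ?_
    · rintro _ rfl; exact ⟨hz, fun h => (hBs h).2 rfl⟩
    · rintro x ⟨hx, hxB⟩
      refine ⟨z0, rfl, cD.reach_avoid hz ?_ (fun h => (hBs h).2 rfl) hx hxB⟩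
      intro u hu v hv hvz huv
      exact comp_closed hyD hu ⟨hv, hvz⟩ huv
  · by_contra hcon
    have hone : ∀ u ∈ C, ∀ v ∈ C, (∃ b ∈ B, G.Adj b u) → (∃ b ∈ B, G.Adj b v) → u = v := by
      intro u hu v hv h1 h2
      by_contra hne
      exact hcon ⟨u, hu, v, hv, hne, h1, h2⟩
    have hnb : ∀ w ∈ nb G U B, w = z0 ∨ w ∈ C := by
      rintro w ⟨hwU, hwB, k, hk, hkw⟩
      by_cases hwD : w ∈ D
      · left
        by_contra hwz
        exact hwB (comp_closed hyD hk ⟨hwD, hwz⟩ hkw)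
      · exact Or.inr (hND k (hBs hk).1 w hwU hwD hkw)
    have h3 := hcut B (fun x hx => hDU (hBs hx).1) (fun h => (hBs h).2 rfl)
      (fun h => hCD s hsC (hBs h).1) (comp_conn y) (by
        by_contra hall
        push Not at hall
        have h1 := hall s (hCU hsC) (fun h => hCD s hsC (hBs h).1)
        have h2 := hall r (hCU hr) (fun h => hCD r hr (hBs h).1)
        exact hrs (hone s hsC r hr h1.2.2 h2.2.2))
    obtain ⟨p1, p2, p3, h1, h2, h3, n12, n13, n23⟩ :=
      (Set.two_lt_ncard_iff (Set.toFinite _)).1 h3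
    have hC : ∀ p ∈ nb G U B, ∀ q ∈ nb G U B, p ∈ C → q ∈ C → p = q :=
      fun p hp q hq hpC hqC => hone p hpC q hqC hp.2.2 hq.2.2
    rcases hnb p1 h1 with s1 | s1 <;> rcases hnb p2 h2 with s2 | s2 <;>
      rcases hnb p3 h3 with s3 | s3
    · exact n12 (s1.trans s2.symm)
    · exact n12 (s1.trans s2.symm)
    · exact n13 (s1.trans s3.symm)
    · exact n23 (hC _ h2 _ h3 s2 s3)
    · exact n23 (s2.trans s3.symm)
    · exact n13 (hC _ h1 _ h3 s1 s3)
    · exact n12 (hC _ h1 _ h2 s1 s2)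
    · exact n12 (hC _ h1 _ h2 s1 s2)

set_option maxHeartbeats 1000000 in
theorem sweep [Finite V] {z0 s : V} (hf : Free G U) (hcut : NoCut G U z0 s) (hzs : G.Adj z0 s) :
    ∀ (n : ℕ) (D : Set V) (c : List V), D.ncard = n + 1 → c ≠ [] → (s :: c).Nodup →
      List.IsChain G.Adj (s :: c ++ [s]) → Conn G D → z0 ∈ D → D ⊆ U → (∀ x ∈ s :: c, x ∈ U) →
      (∀ x ∈ s :: c, x ∉ D) →
      (∀ d ∈ D, ∀ v ∈ U, v ∉ D → G.Adj d v → v ∈ s :: c) →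
      ∃ (c' : List V) (t : ℕ) (P : Set (V × V)), Run (s :: c ++ [s]) (D \ {z0}) P t (s :: c' ++ [s]) ∧
        t + c'.length = 2 * n + c.length ∧ (∀ v ∈ U, G.Adj z0 v → v ∈ s :: c') ∧
        ∀ u ∈ D, u ≠ z0 → ∀ v ∈ U, v ≠ z0 → G.Adj u v → Seen P u v := by
  intro n
  induction n using Nat.strong_induction_on with
  | _ n ih =>
  intro D c hn hc hnd hch cD hz hDU hcU hcD hND
  by_cases hD1 : D = {z0}
  · subst hD1
    simp only [Set.ncard_singleton] at hn
    refine ⟨c, 0, ∅, (Run.nil _).cast (by simp) rfl rfl, by omega, ?_, ?_⟩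
    · intro v hv hadj
      refine hND z0 rfl v hv ?_ hadj
      rintro rfl
      exact G.loopless.irrefl _ hadj
    · rintro u rfl h; exact absurd rfl h
  obtain ⟨y, hy, hyz⟩ : ∃ y ∈ D, y ≠ z0 := by
    by_contra hcon
    push Not at hcon
    exact hD1 (Set.eq_singleton_iff_unique_mem.2 ⟨hz, hcon⟩)
  obtain ⟨r, hr, hrs⟩ : ∃ r ∈ s :: c, s ≠ r := by
    obtain ⟨r, c, rfl⟩ := List.exists_cons_of_ne_nil hc
    refine ⟨r, by simp, ?_⟩
    rintro rfl
    simp at hnd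
  obtain ⟨B, ⟨hBD, hzB, cB, cDB, u, hu, v, hv, huv, hBu, hBv⟩, hmin⟩ := exists_min_set _
    (exists_piece (C := {x | x ∈ s :: c}) hcut cD hz hDU hy hyz hcD hcU (by simp) hND hr hrs)
  have hmin1 : ∀ Q ⊆ B, Q ≠ B → Conn G Q → Conn G (D \ Q) → ∀ u ∈ {x | x ∈ s :: c},
      ∀ v ∈ {x | x ∈ s :: c},
      (∃ q ∈ Q, G.Adj q u) → (∃ q ∈ Q, G.Adj q v) → u = v := by
    intro Q hQ hne cQ cDQ u hu v hv h1 h2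
    by_contra huv
    exact hmin Q hQ hne ⟨hQ.trans hBD, fun h => hzB (hQ h), cQ, cDQ, u, hu, v, hv, huv, h1, h2⟩
  have tBD : Touch G B (D \ B) := by
    obtain ⟨b, hb⟩ := cB.1
    obtain ⟨p, _, hp, q, hqD, hqB, hpq⟩ := cD.exists_edge (A := B) (hBD hb) hb hz hzB
    exact ⟨p, hp, q, ⟨hqD, hqB⟩, hpq⟩
  have hsD : s ∉ D := hcD s (by simp)
  have hall := all_adj (C := {x | x ∈ s :: c}) hBD hDU hz hzB hsD cB cDB tBD hND hcD hcut hmin1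
    hu hv huv hBu hBv
  have hmin2 : ∀ Q ⊆ B, Q ≠ B → Conn G Q → ∀ u ∈ s :: c, ∀ v ∈ s :: c,
      (∃ q ∈ Q, G.Adj q u) → (∃ q ∈ Q, G.Adj q v) → u = v := by
    intro Q hQ hne cQ
    refine hmin1 Q hQ hne cQ (cDB.extend (fun x hx => ⟨hx.1, fun h => hx.2 (hQ h)⟩) ?_)
    rintro x ⟨hxD, hxQ⟩
    by_cases hxB : x ∈ B
    · obtain ⟨d, hd, hxd⟩ := hall x hxB
      exact ⟨d, hd, Reach.one hxd ⟨hxD, hxQ⟩ ⟨hd.1, fun h => hd.2 (hQ h)⟩⟩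
    · exact ⟨x, ⟨hxD, hxB⟩, .refl⟩
  obtain ⟨X, M, Y, α, δ, a, e, hcX, hXa, hYe, hae, hBa, hBe, hMD, hBC⟩ :=
    segment_list (U := U) hnd hch hc cB cDB Set.disjoint_sdiff_right tBD
      (fun x hx h => hcD x hx (hBD h)) (fun x hx h => hcD x hx h.1) hcU
      (hBD.trans hDU) (Set.sdiff_subset.trans hDU) hf ⟨z0, ⟨hz, hzB⟩, hzs⟩ huv hu hv hBu hBv
  have haC : a ∈ s :: c := by
    have : a ∈ s :: X := by rw [hXa]; simp
    rw [hcX]; simp at this ⊢; tauto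
  have heC : e ∈ s :: c := by
    have : e ∈ Y ++ [s] := by rw [hYe]; simp
    rw [hcX]; simp at this ⊢; tauto
  have hmin3 : ∀ Q ⊆ B, Q ≠ B → Conn G Q → (∃ q ∈ Q, G.Adj q a) → (∃ q ∈ Q, G.Adj q e) → False :=
    fun Q hQ hne cQ h1 h2 => hae (hmin2 Q hQ hne cQ a haC e heC h1 h2)
  obtain ⟨β, P, hrun, hβn, hβm, hβc, hBB, hBa2, hBe2⟩ := peel _ B a M rfl cB hBa hBe hmin3
  have hseen : ∀ b ∈ B, ∀ x ∈ s :: c, G.Adj b x → Seen P b x := by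
    intro b hb x hx hbx
    rcases hBC x hx b hb hbx with rfl | rfl | hxM
    · exact (hBa2 b hb hbx).1
    · exact hBe2 b hb hbx
    · by_cases hba : G.Adj b a
      · exact (hBa2 b hb hba).2 x hxM
      · obtain ⟨b0, hb0, hb0a⟩ := hBa
        obtain ⟨y, hy, hye⟩ := hBe
        have hbb0 : b ≠ b0 := by rintro rfl; exact hba hb0a
        have hyb0 : y ≠ b0 := by
          rintro rfl
          refine hmin3 {y} (by simpa using hb0) ?_ (Conn.singleton y) ⟨y, rfl, hb0a⟩ ⟨y, rfl, hye⟩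
          intro h
          rw [← h] at hb
          exact hbb0 hb
        have cQ := peel_step cB hb0 hy hyb0 hye hb0a hmin3
        have hxe : x = e := by
          refine hmin2 (B \ {b0}) Set.sdiff_subset ?_ cQ x hx e heC ⟨b, ⟨hb, hbb0⟩, hbx⟩
            ⟨y, ⟨hy, hyb0⟩, hye⟩
          intro h
          have : b0 ∈ B \ {b0} := by rw [h]; exact hb0
          exact this.2 rfl
        subst hxe
        exact hBe2 b hb hbx
  -- the new rim
  set c1 := X ++ β ++ Y with hc1
  have hw0 : s :: c ++ [s] = α ++ a :: (M ++ e :: δ) := by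
    calc s :: c ++ [s] = (s :: X) ++ M ++ (Y ++ [s]) := by rw [hcX]; simp
      _ = _ := by rw [hXa, hYe]; simp
  have hw1 : s :: c1 ++ [s] = α ++ a :: (β ++ e :: δ) := by
    calc s :: c1 ++ [s] = (s :: X) ++ β ++ (Y ++ [s]) := by rw [hc1]; simp
      _ = _ := by rw [hXa, hYe]; simp
  have hrun1 : Run (s :: c ++ [s]) B P (B.ncard + M.length) (s :: c1 ++ [s]) := by
    rw [hw0, hw1]
    simpa using hrun.context α δ
  have hβl : β.length = B.ncard := by
    classical
    have : B = (β.toFinset : Set V) := by ext x; simp [hβm]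
    rw [this, Set.ncard_coe_finset, List.toFinset_card_of_nodup hβn]
  have hBpos : 0 < B.ncard := (Set.ncard_pos (Set.toFinite _)).2 cB.1
  have hDn : (D \ B).ncard = n + 1 - B.ncard := by rw [Set.ncard_sdiff hBD (Set.toFinite _), hn]
  have hDpos : 0 < (D \ B).ncard := (Set.ncard_pos (Set.toFinite _)).2 cDB.1
  obtain ⟨c', t, P', hrun', ht, hzc, hed⟩ := ih (n - B.ncard) (by omega) (D \ B) c1 (by omega)
    (by
      intro h
      have : β = [] := by
        have h2 : X ++ β ++ Y = [] := h
        simp only [List.append_eq_nil_iff] at h2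
        exact h2.1.2
      rw [this] at hβl
      simp at hβl
      omega)
    (by
      rw [hcX] at hnd
      have hsub : (s :: (X ++ Y)).Nodup := by
        refine hnd.sublist ?_
        simp
      have hβC : ∀ x ∈ β, x ∉ s :: (X ++ Y) := by
        intro x hx hx2
        refine hcD x ?_ (hBD ((hβm x).1 hx))
        rw [hcX]; simp at hx2 ⊢; tauto
      have hp : (s :: c1).Perm (β ++ s :: (X ++ Y)) := by
        rw [hc1]
        refine List.Perm.trans ?_ (List.perm_middle.symm)
        refine List.Perm.cons s ?_
        rw [List.append_assoc]
        refine (List.perm_append_comm_assoc X β Y)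
      rw [hp.nodup_iff, List.nodup_append]
      exact ⟨hβn, hsub, fun x hx y hy hxy => hβC x hx (hxy ▸ hy)⟩)
    (by
      rw [hw0, List.isChain_split] at hch
      rw [hw1, List.isChain_split]
      refine ⟨hch.1, ?_⟩
      have h2 := hch.2
      rw [← List.cons_append, List.isChain_split] at h2 ⊢
      exact ⟨by simpa using hβc, h2.2⟩)
    cDB ⟨hz, hzB⟩ (Set.sdiff_subset.trans hDU)
    (by
      intro x hx
      by_cases hxB : x ∈ β
      · exact hDU (hBD ((hβm x).1 hxB))
      · apply hcU
        rw [hc1] at hx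
        rw [hcX]; simp at hx ⊢; tauto)
    (by
      intro x hx hxD
      by_cases hxB : x ∈ β
      · exact hxD.2 ((hβm x).1 hxB)
      · refine hcD x ?_ hxD.1
        rw [hc1] at hx
        rw [hcX]; simp at hx ⊢; tauto)
    (by
      intro d hd v hv hvD hdv
      by_cases hvB : v ∈ B
      · have := (hβm v).2 hvB
        rw [hc1]; simp; tauto
      · have h1 := hND d hd.1 v hv (fun h => hvD ⟨h, hvB⟩) hdv
        have h2 : v ∉ M := fun h => hMD v h d hd hdv
        rw [hcX] at h1
        rw [hc1]; simp at h1 ⊢; tauto)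
  refine ⟨c', _, _, (hrun1.trans hrun' ?_).cast ?_ rfl rfl, ?_, hzc, ?_⟩
  · rw [Set.disjoint_left]
    intro x hx hx2
    exact hx2.1.2 hx
  · ext x
    simp only [Set.mem_union, Set.mem_sdiff, Set.mem_singleton_iff]
    constructor
    · rintro (h | h)
      · exact ⟨hBD h, by rintro rfl; exact hzB h⟩
      · exact ⟨h.1.1, h.2⟩
    · rintro ⟨h1, h2⟩
      by_cases hx : x ∈ B
      · exact Or.inl hx
      · exact Or.inr ⟨⟨h1, hx⟩, h2⟩
  · have e1 : c1.length = X.length + β.length + Y.length := by rw [hc1]; simp; omega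
    have e2 : c.length = X.length + M.length + Y.length := by rw [hcX]; simp; omega
    omega
  · intro u hu huz v hv hvz huv
    by_cases huB : u ∈ B
    · by_cases hvB : v ∈ B
      · exact (hBB u huB v hvB huv).mono Set.subset_union_left
      · by_cases hvD : v ∈ D
        · exact ((hed v ⟨hvD, hvB⟩ hvz u (hDU hu) huz huv.symm).symm).mono Set.subset_union_right
        · exact (hseen u huB v (hND u hu v hv hvD huv) huv).mono Set.subset_union_left
    · exact (hed u ⟨hu, huB⟩ huz v hv hvz huv).mono Set.subset_union_right

end GM

namespace GM
variable {V : Type} {G : SimpleGraph V} {U : Set V}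

/-- A run from `[x, y]` to itself inserting all of `U` and seeing all edges inside `U`. -/
def Good (G : SimpleGraph V) (U : Set V) (x y : V) : Prop :=
  ∃ (t : ℕ) (P : Set (V × V)), t + 8 ≤ 4 * U.ncard ∧ Run [x, y] (U \ {x, y}) P t [x, y] ∧
    ∀ u ∈ U, ∀ v ∈ U, G.Adj u v → Seen P u v

theorem good_three [Finite V] {z0 s w : V} (hf : Free G U) (hcut : NoCut G U z0 s)
    (hzs : G.Adj z0 s) (hz : z0 ∈ U) (hs : s ∈ U) (hw : w ∈ U) (hwz : w ≠ z0) (hws : w ≠ s) :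
    Good G U z0 s := by
  have hzs' : z0 ≠ s := hzs.ne
  obtain ⟨t, htU, htz, hst⟩ : ∃ t ∈ U, t ≠ z0 ∧ G.Adj s t := by
    by_contra hcon
    push Not at hcon
    have hwm : w ∈ U \ {z0, s} := ⟨hw, by simp [hwz, hws]⟩
    have hsub : comp G (U \ {z0, s}) w ⊆ U \ {z0, s} := comp_sub hwm
    have hnb : nb G U (comp G (U \ {z0, s}) w) ⊆ {z0} := by
      rintro v ⟨hvU, hvK, k, hk, hkv⟩
      by_contra hvz
      have hvz : v ≠ z0 := hvz
      by_cases hvs : v = s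
      · subst hvs
        have := hsub hk
        simp only [Set.mem_sdiff, Set.mem_insert_iff, Set.mem_singleton_iff, not_or] at this
        exact hcon k this.1 this.2.1 hkv.symm
      · exact hvK (comp_closed hwm hk ⟨hvU, by simp [hvz, hvs]⟩ hkv)
    have h3 := hcut _ (hsub.trans Set.sdiff_subset) (fun h => (hsub h).2 (by simp))
      (fun h => (hsub h).2 (by simp)) (comp_conn w)
      ⟨s, hs, fun h => (hsub h).2 (by simp), fun h => hzs' (hnb h).symm⟩
    have := Set.ncard_le_ncard hnb (Set.toFinite _)
    rw [Set.ncard_singleton] at this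
    omega
  have hst' : s ≠ t := hst.ne
  set D := U \ {s, t} with hD
  have hzD : z0 ∈ D := ⟨hz, by simp [hzs', htz.symm]⟩
  have hDs : s ∉ D := fun h => h.2 (by simp)
  have hDt : t ∉ D := fun h => h.2 (by simp)
  have hmemD : ∀ x ∈ U, x ∉ D → x = s ∨ x = t := by
    intro x hx hxD
    by_contra hcon
    exact hxD ⟨hx, by simpa using hcon⟩
  have cD : Conn G D := by
    refine (Conn.singleton z0).extend (by simpa using hzD) ?_
    intro x hx
    refine ⟨z0, rfl, ?_⟩
    by_contra hcon
    have hsub : comp G D x ⊆ D := comp_sub hx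
    have hnb : nb G U (comp G D x) ⊆ {s, t} := by
      rintro v ⟨hvU, hvK, k, hk, hkv⟩
      exact hmemD v hvU (fun hvD => hvK (comp_closed hx hk hvD hkv))
    have h3 := hcut _ (hsub.trans Set.sdiff_subset) hcon (fun h => hDs (hsub h)) (comp_conn x)
      ⟨z0, hz, hcon, fun h => hzD.2 (hnb h)⟩
    have := Set.ncard_le_ncard hnb (Set.toFinite _)
    rw [Set.ncard_pair hst'] at this
    omega
  have hcard : D.ncard + 2 = U.ncard := by
    have hsub : ({s, t} : Set V) ⊆ U := by
      rintro x (rfl | rfl)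
      · exact hs
      · exact htU
    have := Set.ncard_sdiff_add_ncard_of_subset hsub (Set.toFinite _)
    rwa [Set.ncard_pair hst'] at this
  have hDpos : 0 < D.ncard := (Set.ncard_pos (Set.toFinite _)).2 ⟨z0, hzD⟩
  obtain ⟨c', tt, P, hrun, htt, hzc, hed⟩ := sweep hf hcut hzs (D.ncard - 1) D [t] (by omega)
    (by simp) (by simpa using hst') (by simp [hst, hst.symm]) cD hzD Set.sdiff_subset
    (by simp [hs, htU]) (by simp [hDs, hDt]) (by
      intro d hd v hv hvD _
      simpa using hmemD v hv hvD)
  have r1 := (((Run.dup [z0] s []).trans (Run.ins [z0] s t [s]) (by simp)).trans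
    (Run.see [z0] s t [s]) (by simp)).trans
    (by simpa using hrun.context [z0] []) (by
      simp only [Set.empty_union, Set.union_empty, Set.disjoint_singleton_left]
      exact fun h => hDt h.1)
  have r2 := r1.trans (by simpa using Run.delAll [] z0 (s :: c') [s]) (by simp)
  refine ⟨_, _, ?_, r2.cast ?_ rfl rfl, ?_⟩
  · simp at htt ⊢
    omega
  · ext x
    simp only [Set.empty_union, Set.union_empty, Set.mem_union, Set.mem_singleton_iff,
      Set.mem_sdiff, Set.mem_insert_iff, not_or]
    constructor
    · rintro (rfl | h)
      · exact ⟨htU, htz, hst'.symm⟩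
      · refine ⟨h.1.1, h.2, ?_⟩
        rintro rfl
        exact hDs h.1
    · rintro ⟨h1, h2, h3⟩
      by_cases hxt : x = t
      · exact Or.inl hxt
      · exact Or.inr ⟨⟨h1, by simp [h3, hxt]⟩, h2⟩
  · have hz2 : ∀ v ∈ U, G.Adj z0 v → Seen (∅ ∪ ∅ ∪ {(s, t)} ∪ P ∪
        {p : V × V | p.1 = z0 ∧ (p.2 = s ∨ p.2 ∈ c')}) z0 v := by
      intro v hv hzv
      exact Or.inl (Or.inr ⟨rfl, by simpa using hzc v hv hzv⟩)
    have hPs : P ⊆ (∅ ∪ ∅ ∪ {(s, t)} ∪ P ∪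
        {p : V × V | p.1 = z0 ∧ (p.2 = s ∨ p.2 ∈ c')}) := by
      intro p hp; simp only [Set.mem_union]; tauto
    have hst2 : Seen (∅ ∪ ∅ ∪ {(s, t)} ∪ P ∪
        {p : V × V | p.1 = z0 ∧ (p.2 = s ∨ p.2 ∈ c')}) s t := by
      left; simp
    intro u hu v hv huv
    by_cases huz : u = z0
    · subst huz; exact hz2 v hv huv
    by_cases hvz : v = z0
    · subst hvz; exact (hz2 u hu huv.symm).symm
    by_cases huD : u ∈ D
    · exact (hed u huD huz v hv hvz huv).mono hPs
    by_cases hvD : v ∈ D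
    · exact ((hed v hvD hvz u hu huz huv.symm).symm).mono hPs
    rcases hmemD u hu huD with rfl | rfl <;> rcases hmemD v hv hvD with rfl | rfl
    · exact absurd huv (G.loopless.irrefl _)
    · exact hst2
    · exact hst2.symm
    · exact absurd huv (G.loopless.irrefl _)

/-- Both sides of a minimal cut pair are attached to the base side. -/
theorem cut_side [Finite V] {K : Set V} {x y z z' : V} (hnb : nb G U K = {x, y})
    (hzU : z ∈ U) (hzK : z ∉ K) (hzK' : z' ∉ K) (hzU' : z' ∈ U) (hzz : G.Adj z z')
    (hzx : z ≠ x) (hzy : z ≠ y) (hxy : x ≠ y)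
    (hmin : ∀ K' ⊆ U, z ∉ K' → z' ∉ K' → Conn G K' → (∃ w ∈ U, w ∉ K' ∧ w ∉ nb G U K') →
      2 ≤ (nb G U K').ncard) :
    ∃ q ∈ comp G (U \ (K ∪ {x, y})) z, G.Adj x q := by
  by_contra hcon
  push Not at hcon
  have hz : z ∈ U \ (K ∪ {x, y}) := ⟨hzU, by simp [hzK, hzx, hzy]⟩
  set Q := comp G (U \ (K ∪ {x, y})) z with hQ
  have hQs : Q ⊆ U \ (K ∪ {x, y}) := comp_sub hz
  have hzQ : z ∈ Q := mem_comp z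
  have hxnb : x ∈ nb G U K := by rw [hnb]; simp
  have hynb : y ∈ nb G U K := by rw [hnb]; simp
  have hz'Q : z' ∈ Q ∪ {y} := by
    by_contra h
    have h1 : z' ∉ Q := fun h' => h (Or.inl h')
    have h2 : z' ≠ y := fun h' => h (Or.inr h')
    have h3 : z' ≠ x := by
      rintro rfl
      exact hcon z hzQ hzz.symm
    exact h1 (comp_closed hz hzQ ⟨hzU', by simp [hzK', h2, h3]⟩ hzz)
  have hx' : x ∈ U \ (Q ∪ {y}) := ⟨hxnb.1, by
    rintro (h | h)
    · exact (hQs h).2 (by simp)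
    · exact hxy h⟩
  have hsub : comp G (U \ (Q ∪ {y})) x ⊆ U \ (Q ∪ {y}) := comp_sub hx'
  have hnb2 : nb G U (comp G (U \ (Q ∪ {y})) x) ⊆ {y} := by
    rintro v ⟨hvU, hvK, k, hk, hkv⟩
    by_contra hvy
    have hvy : v ≠ y := hvy
    by_cases hvQ : v ∈ Q
    · have hkU := hsub hk
      have hv2 := hQs hvQ
      by_cases hkK : k ∈ K
      · refine hv2.2 (Or.inr ?_)
        rw [← hnb]
        exact ⟨hvU, fun h => hv2.2 (Or.inl h), k, hkK, hkv⟩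
      · by_cases hkx : k = x
        · subst hkx; exact hcon v hvQ hkv
        · have hky : k ≠ y := by rintro rfl; exact hkU.2 (Or.inr rfl)
          exact hkU.2 (Or.inl (comp_closed hz hvQ ⟨hkU.1, by simp [hkK, hkx, hky]⟩ hkv.symm))
    · exact hvK (comp_closed hx' hk ⟨hvU, by simp [hvQ, hvy]⟩ hkv)
  have h3 := hmin _ (hsub.trans Set.sdiff_subset) (fun h => (hsub h).2 (Or.inl hzQ))
    (fun h => (hsub h).2 hz'Q) (comp_conn x)
    ⟨z, hzU, fun h => (hsub h).2 (Or.inl hzQ), fun h => hzy (hnb2 h)⟩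
  have := Set.ncard_le_ncard hnb2 (Set.toFinite _)
  rw [Set.ncard_singleton] at this
  omega

end GM

namespace GM
variable {V : Type} {G : SimpleGraph V} {U : Set V}

/-- Attaching a piece hanging at a cut vertex. -/
theorem ear_run [Finite V] {K : Set V} {x v u : V} (hx : x ∉ K) (hv : v ∈ K)
    (h1 : Good G (insert x K) x v) (h2 : Good G (insert x K) v x) :
    ∃ t P, t + 2 ≤ 4 * K.ncard ∧ (∃ t' P', t' + 2 ≤ 4 * K.ncard ∧ Run [x, u] K P t [x, u] ∧
      Run [u, x] K P' t' [u, x] ∧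
      (∀ a ∈ insert x K, ∀ b ∈ insert x K, G.Adj a b → Seen P a b ∧ Seen P' a b)) := by
  obtain ⟨t, P, ht, hr, hs⟩ := h1
  obtain ⟨t', P', ht', hr', hs'⟩ := h2
  rw [Set.ncard_insert_of_notMem hx (Set.toFinite _)] at ht ht'
  have hvx : v ≠ x := by rintro rfl; exact hx hv
  have r1 := ((Run.ins [] x v [u]).trans (by simpa using hr.context [] [u]) (by simp)).trans
    (Run.del [] x v [u]) (by simp)
  have r2 := ((Run.ins [] u v [x]).trans (by simpa using hr'.context [u] []) (by simp)).trans
    (Run.del [] u v [x]) (by simp)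
  refine ⟨_, _, ?_, _, _, ?_, r1.cast ?_ rfl rfl, r2.cast ?_ rfl rfl, ?_⟩
  · omega
  · omega
  · ext a
    simp only [Set.mem_union, Set.mem_singleton_iff, Set.mem_sdiff, Set.mem_insert_iff,
      Set.mem_empty_iff_false, or_false]
    by_cases ha : a = v
    · subst ha; simp [hv]
    · by_cases hax : a = x
      · subst hax; simp [hx, ha]
      · simp [ha, hax]
  · ext a
    simp only [Set.mem_union, Set.mem_singleton_iff, Set.mem_sdiff, Set.mem_insert_iff,
      Set.mem_empty_iff_false, or_false]
    by_cases ha : a = v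
    · subst ha; simp [hv]
    · by_cases hax : a = x
      · subst hax; simp [hx, ha]
      · simp [ha, hax]
  · intro a ha b hb hab
    exact ⟨(hs a ha b hb hab).mono (by intro p hp; simp [hp]),
      (hs' a ha b hb hab).mono (by intro p hp; simp [hp])⟩

theorem good_main [Finite V] : ∀ (n : ℕ) (G : SimpleGraph V) (U : Set V) (x0 y0 : V),
    U.ncard = n → x0 ∈ U → y0 ∈ U → G.Adj x0 y0 → Free G U → Good G U x0 y0 := by
  classical
  intro n
  induction n using Nat.strong_induction_on with
  | _ n ih =>
  intro G U x0 y0 hn hx0 hy0 hxy0 hf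
  have hne0 := hxy0.ne
  by_cases hthird : ∃ w ∈ U, w ≠ x0 ∧ w ≠ y0
  swap
  · push Not at hthird
    have hU : U = {x0, y0} := by
      ext w
      simp only [Set.mem_insert_iff, Set.mem_singleton_iff]
      constructor
      · intro hw
        by_cases h : w = x0
        · exact Or.inl h
        · exact Or.inr (hthird w hw h)
      · rintro (rfl | rfl)
        · exact hx0
        · exact hy0
    subst hU
    refine ⟨0, _, ?_, (Run.see [] x0 y0 []).cast (by simp) rfl rfl, ?_⟩
    · rw [Set.ncard_pair hne0]
    · rintro u (rfl | rfl) v (rfl | rfl) huv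
      · exact absurd huv (G.loopless.irrefl _)
      · exact Or.inl rfl
      · exact Or.inr rfl
      · exact absurd huv (G.loopless.irrefl _)
  by_cases hcut : NoCut G U x0 y0
  · obtain ⟨w, hw, hw1, hw2⟩ := hthird
    exact good_three hf hcut hxy0 hx0 hy0 hw hw1 hw2
  -- choose a cut of minimal order
  let Cut : ℕ → Prop := fun m => ∃ K ⊆ U, x0 ∉ K ∧ y0 ∉ K ∧ Conn G K ∧
    (∃ w ∈ U, w ∉ K ∧ w ∉ nb G U K) ∧ (nb G U K).ncard = m
  have hex : ∃ m, Cut m ∧ m < 3 := by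
    unfold NoCut at hcut
    push Not at hcut
    obtain ⟨K, h1, h2, h3, h4, ⟨w, hw, hw1, hw2⟩, h6⟩ := hcut
    exact ⟨_, ⟨K, h1, h2, h3, h4, ⟨w, hw, hw1, hw2⟩, rfl⟩, h6⟩
  obtain ⟨m, ⟨K, hKU, hxK, hyK, cK, ⟨w, hw, hwK, hwN⟩, hm⟩, hm3, hmin⟩ :
      ∃ m, Cut m ∧ m < 3 ∧ ∀ m', Cut m' → m ≤ m' := by
    obtain ⟨m, h1, h2⟩ := hex
    have h : ∃ m, Cut m := ⟨m, h1⟩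
    exact ⟨Nat.find h, Nat.find_spec h, (Nat.find_min' h h1).trans_lt h2,
      fun m' hm' => Nat.find_min' h hm'⟩
  have hKpos : 0 < K.ncard := (Set.ncard_pos (Set.toFinite _)).2 cK.1
  have hUK : (U \ K).ncard + K.ncard = U.ncard := Set.ncard_sdiff_add_ncard_of_subset hKU
  have hx0' : x0 ∈ U \ K := ⟨hx0, hxK⟩
  have hy0' : y0 ∈ U \ K := ⟨hy0, hyK⟩
  have hIK : (U \ K) \ {x0, y0} ∪ K = U \ {x0, y0} := by
    ext a
    simp only [Set.mem_union, Set.mem_sdiff, Set.mem_insert_iff, Set.mem_singleton_iff]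
    constructor
    · rintro (h | h)
      · exact ⟨h.1.1, h.2⟩
      · refine ⟨hKU h, ?_⟩
        rintro (rfl | rfl)
        · exact hxK h
        · exact hyK h
    · rintro ⟨h1, h2⟩
      by_cases ha : a ∈ K
      · exact Or.inr ha
      · exact Or.inl ⟨⟨h1, ha⟩, h2⟩
  have hdK : Disjoint ((U \ K) \ {x0, y0}) K := by
    rw [Set.disjoint_left]
    exact fun a ha => ha.1.2
  have hsplit : ∀ (P1 P2 : Set (V × V)), (∀ u ∈ U \ K, ∀ v ∈ U \ K, G.Adj u v → Seen P1 u v) →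
      (∀ u ∈ K, ∀ v ∈ K ∪ nb G U K, G.Adj u v → Seen P2 u v) →
      ∀ u ∈ U, ∀ v ∈ U, G.Adj u v → Seen (P1 ∪ P2) u v := by
    intro P1 P2 h1 h2 u hu v hv huv
    have key : ∀ u ∈ K, ∀ v ∈ U, G.Adj u v → Seen (P1 ∪ P2) u v := by
      intro u hu v hv huv
      refine (h2 u hu v ?_ huv).mono Set.subset_union_right
      by_cases hvK : v ∈ K
      · exact Or.inl hvK
      · exact Or.inr ⟨hv, hvK, u, hu, huv⟩
    by_cases huK : u ∈ K
    · exact key u huK v hv huv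
    · by_cases hvK : v ∈ K
      · exact (key v hvK u hu huv.symm).symm
      · exact (h1 u ⟨hu, huK⟩ v ⟨hv, hvK⟩ huv).mono Set.subset_union_left
  obtain h0 | h1 | h2 : m = 0 ∨ m = 1 ∨ m = 2 := by omega
  · -- a separate component
    subst h0
    have hN : nb G U K = ∅ := (Set.ncard_eq_zero (Set.toFinite _)).1 hm
    obtain ⟨t, P, ht, hr, hs⟩ := ih _ (by omega) G (U \ K) x0 y0 rfl hx0' hy0' hxy0
      (hf.mono Set.sdiff_subset)
    obtain ⟨t2, P2, ht2, hr2, hs2⟩ : ∃ (t2 : ℕ) (P2 : Set (V × V)), t2 ≤ 4 * K.ncard ∧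
        Run [x0, y0] K P2 t2 [x0, y0] ∧ ∀ u ∈ K, ∀ v ∈ K, G.Adj u v → Seen P2 u v := by
      obtain ⟨v, hv⟩ := cK.1
      by_cases hK1 : K = {v}
      · subst hK1
        refine ⟨2, _, by simp, ((Run.ins [] x0 v [y0]).trans (Run.del [] x0 v [y0])
          (by simp)).cast (by simp) rfl rfl, ?_⟩
        rintro _ rfl _ rfl h
        exact absurd h (G.loopless.irrefl _)
      · obtain ⟨v2, hv2, hv2v⟩ : ∃ v2 ∈ K, v2 ≠ v := by
          by_contra hcon
          push Not at hcon
          exact hK1 (Set.eq_singleton_iff_unique_mem.2 ⟨hv, hcon⟩)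
        obtain ⟨p, hp, rfl, q, hq, _, hpq⟩ := cK.exists_edge (A := {v}) hv rfl hv2 hv2v
        have hlt : K.ncard < n := by
          rw [← hn]
          have : 0 < (U \ K).ncard := (Set.ncard_pos (Set.toFinite _)).2 ⟨x0, hx0'⟩
          omega
        obtain ⟨t2, P2, ht2, hr2, hs2⟩ := ih _ hlt G K p q rfl hp hq hpq (hf.mono hKU)
        have r := ((((Run.ins [] x0 p [y0]).trans (Run.ins [x0] p q [y0])
          (by simpa using hpq.ne)).trans (by simpa using hr2.context [x0] [y0])
          (by
            rw [Set.disjoint_left]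
            rintro a (rfl | rfl) h
            · exact h.2 (by simp)
            · exact h.2 (by simp))).trans (Run.del [x0] p q [y0]) (by simp)).trans
          (Run.del [] x0 p [y0]) (by simp)
        refine ⟨_, _, ?_, r.cast ?_ rfl rfl, ?_⟩
        · omega
        · ext a
          simp only [Set.mem_union, Set.mem_singleton_iff, Set.mem_sdiff, Set.mem_insert_iff,
            Set.mem_empty_iff_false, or_false]
          by_cases ha : a = p
          · subst ha; simp [hp]
          · by_cases haq : a = q
            · subst haq; simp [hq]
            · simp [ha, haq]
        · intro a ha b hb hab
          exact (hs2 a ha b hb hab).mono (by intro p hp; simp [hp])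
    refine ⟨_, _, ?_, (hr.trans hr2 hdK).cast hIK rfl rfl, ?_⟩
    · omega
    · refine hsplit P P2 hs ?_
      rw [hN, Set.union_empty]
      exact hs2
  · -- a cut vertex
    subst h1
    obtain ⟨x, hN⟩ := Set.ncard_eq_one.1 hm
    have hxN : x ∈ nb G U K := by rw [hN]; rfl
    obtain ⟨hxU, hxK', v, hvK, hvx⟩ := hxN
    have hwx : w ≠ x := by rintro rfl; rw [hN] at hwN; exact hwN rfl
    obtain ⟨u, huU, huK, hxu⟩ : ∃ u ∈ U, u ∉ K ∧ G.Adj x u := by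
      by_contra hcon
      push Not at hcon
      have hxx : x ≠ x0 := by rintro rfl; exact hcon y0 hy0 hyK hxy0
      have hxy : x ≠ y0 := by rintro rfl; exact hcon x0 hx0 hxK hxy0.symm
      have hN2 : nb G U (K ∪ {x}) = ∅ := by
        rw [Set.eq_empty_iff_forall_notMem]
        rintro a ⟨haU, haK, k, hk, hka⟩
        simp only [Set.mem_union, Set.mem_singleton_iff, not_or] at haK
        rcases hk with hk | rfl
        · have : a ∈ nb G U K := ⟨haU, haK.1, k, hk, hka⟩
          rw [hN] at this
          exact haK.2 this
        · exact hcon a haU haK.1 hka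
      have := hmin 0 ⟨K ∪ {x}, Set.union_subset hKU (by simpa using hxU), by simp [hxK, hxx.symm],
        by simp [hyK, hxy.symm], cK.union (Conn.singleton x) ⟨v, hvK, x, rfl, Or.inr hvx⟩,
        ⟨x0, hx0, by simp [hxK, hxx.symm], by rw [hN2]; exact Set.notMem_empty _⟩, by rw [hN2]; exact Set.ncard_empty _⟩
      omega
    have hKx : (insert x K).ncard < n := by
      rw [← hn]
      refine Set.ncard_lt_ncard ?_ (Set.toFinite _)
      refine ⟨Set.insert_subset hxU hKU, fun h => ?_⟩
      rcases h hw with h | h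
      · exact hwx h
      · exact hwK h
    have hfx : Free G (insert x K) := hf.mono (Set.insert_subset hxU hKU)
    obtain ⟨t, P, ht, hr, hs⟩ := ih _ (by omega) G (U \ K) x0 y0 rfl hx0' hy0' hxy0
      (hf.mono Set.sdiff_subset)
    obtain ⟨t2, P2, ht2, t3, P3, ht3, hr2, hr3, hs2⟩ := ear_run (u := u) hxK' hvK
      (ih _ hKx G _ x v rfl (by simp) (by simp [hvK]) hvx.symm hfx)
      (ih _ hKx G _ v x rfl (by simp [hvK]) (by simp) hvx hfx)
    have hsub : K ∪ nb G U K ⊆ insert x K := by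
      rw [hN]
      rintro a (ha | ha)
      · exact Or.inr ha
      · exact Or.inl ha
    rcases hs x ⟨hxU, hxK'⟩ u ⟨huU, huK⟩ hxu with hxuP | huxP
    · refine ⟨_, _, ?_, (hr.splice hxuP hr2 hdK).cast hIK rfl rfl, ?_⟩
      · omega
      · exact hsplit P P2 hs (fun a ha b hb hab =>
          (hs2 a (hsub (Or.inl ha)) b (hsub hb) hab).1)
    · refine ⟨_, _, ?_, (hr.splice huxP hr3 hdK).cast hIK rfl rfl, ?_⟩
      · omega
      · exact hsplit P P3 hs (fun a ha b hb hab =>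
          (hs2 a (hsub (Or.inl ha)) b (hsub hb) hab).2)
  · -- a cut pair
    subst h2
    obtain ⟨x, y, hxy, hN⟩ := Set.ncard_eq_two.1 hm
    have hxN : x ∈ nb G U K := by rw [hN]; simp
    have hyN : y ∈ nb G U K := by rw [hN]; simp
    obtain ⟨hxU, hxK', vx, hvx, hvxx⟩ := hxN
    obtain ⟨hyU, hyK', vy, hvy, hvyy⟩ := hyN
    set G' := G ⊔ SimpleGraph.edge x y with hG'
    have hGG' : G ≤ G' := le_sup_left
    have hxy' : G'.Adj x y := by
      right
      rw [SimpleGraph.edge_adj]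
      exact ⟨Or.inl ⟨rfl, rfl⟩, hxy⟩
    have hKxyU : K ∪ {x, y} ⊆ U := by
      refine Set.union_subset hKU ?_
      rintro a (rfl | rfl)
      · exact hxU
      · exact hyU
    have hf1 : Free G' (U \ K) := by
      have : (U \ K) ∪ K ⊆ U := Set.union_subset Set.sdiff_subset hKU
      constructor
      · intro h
        exact hf.1 ((h.virtual cK Set.disjoint_sdiff_left ⟨vx, hvx, hvxx.symm⟩
          ⟨vy, hvy, hvyy.symm⟩).mono this)
      · intro h
        exact hf.2 ((h.virtual cK Set.disjoint_sdiff_left ⟨vx, hvx, hvxx.symm⟩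
          ⟨vy, hvy, hvyy.symm⟩).mono this)
    have hf2 : Free G' (K ∪ {x, y}) := by
      by_cases hadj : G.Adj x y
      · have : G' = G := by
          rw [hG', sup_eq_left]
          exact (SimpleGraph.edge_le_iff G).2 (Or.inr hadj)
        rw [this]
        exact hf.mono hKxyU
      · obtain ⟨z, z', hzU, hzK, hzK', hzU', hzz, hzx, hzy, hzmin⟩ : ∃ z z', z ∈ U ∧ z ∉ K ∧
            z' ∉ K ∧ z' ∈ U ∧ G.Adj z z' ∧ z ≠ x ∧ z ≠ y ∧
            (∀ K' ⊆ U, z ∉ K' → z' ∉ K' → Conn G K' → (∃ w ∈ U, w ∉ K' ∧ w ∉ nb G U K') →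
              2 ≤ (nb G U K').ncard) := by
          by_cases hx0x : x0 ≠ x ∧ x0 ≠ y
          · exact ⟨x0, y0, hx0, hxK, hyK, hy0, hxy0, hx0x.1, hx0x.2,
              fun K' a b c d e => hmin _ ⟨K', a, b, c, d, e, rfl⟩⟩
          · refine ⟨y0, x0, hy0, hyK, hxK, hx0, hxy0.symm, ?_, ?_,
              fun K' a b c d e => hmin _ ⟨K', a, c, b, d, e, rfl⟩⟩
            · rintro rfl
              apply hx0x
              refine ⟨hne0, ?_⟩
              rintro rfl
              exact hadj hxy0.symm
            · rintro rfl
              apply hx0x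
              refine ⟨?_, hne0⟩
              rintro rfl
              exact hadj hxy0
        have hq1 := cut_side hN hzU hzK hzK' hzU' hzz hzx hzy hxy hzmin
        have hq2 := cut_side (hN.trans (Set.pair_comm x y)) hzU hzK hzK' hzU' hzz hzy hzx hxy.symm
          hzmin
        rw [Set.pair_comm y x] at hq2
        have hz : z ∈ U \ (K ∪ {x, y}) := ⟨hzU, by simp [hzK, hzx, hzy]⟩
        have hQs := comp_sub (G := G) hz
        have hdis : Disjoint (K ∪ {x, y}) (comp G (U \ (K ∪ {x, y})) z) := by
          rw [Set.disjoint_left]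
          exact fun a ha h => (hQs h).2 ha
        have hsubU : K ∪ {x, y} ∪ comp G (U \ (K ∪ {x, y})) z ⊆ U :=
          Set.union_subset hKxyU (hQs.trans Set.sdiff_subset)
        exact ⟨fun h => hf.1 ((h.virtual (comp_conn z) hdis hq1 hq2).mono hsubU),
          fun h => hf.2 ((h.virtual (comp_conn z) hdis hq1 hq2).mono hsubU)⟩
    have hdxy : Disjoint K {x, y} := by
      rw [Set.disjoint_right]
      rintro a (rfl | rfl)
      · exact hxK'
      · exact hyK'
    have hcardK : (K ∪ {x, y}).ncard = K.ncard + 2 := by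
      rw [Set.ncard_union_eq hdxy, Set.ncard_pair hxy]
    have hlt : (K ∪ {x, y}).ncard < n := by
      rw [← hn]
      refine Set.ncard_lt_ncard ⟨hKxyU, fun h => ?_⟩ (Set.toFinite _)
      rcases h hw with h | h
      · exact hwK h
      · rw [← hN] at h; exact hwN h
    obtain ⟨t, P, ht, hr, hs⟩ := ih _ (by omega) G' (U \ K) x0 y0 rfl hx0' hy0' (hGG' hxy0) hf1
    have hJ : (K ∪ {x, y}) \ {x, y} = K := by
      rw [Set.union_sdiff_right]
      exact sdiff_eq_left.2 hdxy
    rcases hs x ⟨hxU, hxK'⟩ y ⟨hyU, hyK'⟩ hxy' with h | h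
    · obtain ⟨t2, P2, ht2, hr2, hs2⟩ := ih _ hlt G' (K ∪ {x, y}) x y rfl (by simp) (by simp)
        hxy' hf2
      rw [hJ] at hr2
      refine ⟨_, _, ?_, (hr.splice h hr2 hdK).cast hIK rfl rfl, ?_⟩
      · omega
      · refine hsplit P P2 (fun a ha b hb hab => hs a ha b hb (hGG' hab))
          (fun a ha b hb hab => hs2 a (Or.inl ha) b ?_ (hGG' hab))
        rwa [hN] at hb
    · obtain ⟨t2, P2, ht2, hr2, hs2⟩ := ih _ hlt G' (K ∪ {x, y}) y x rfl (by simp) (by simp)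
        hxy'.symm hf2
      rw [Set.pair_comm y x, hJ] at hr2
      refine ⟨_, _, ?_, (hr.splice h hr2 hdK).cast hIK rfl rfl, ?_⟩
      · omega
      · refine hsplit P P2 (fun a ha b hb hab => hs a ha b hb (hGG' hab))
          (fun a ha b hb hab => hs2 a (Or.inl ha) b ?_ (hGG' hab))
        rwa [hN] at hb

end GM

theorem stmt15 (V : Type) [Fintype V] (G : SimpleGraph V)
    (h5 : ¬ IsMinorOf K5 G) (h33 : ¬ IsMinorOf K33 G) :
    IsMinorOf G (gridGraph (4 * Fintype.card V)) := by
  classical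
  by_cases hedge : ∃ x y, G.Adj x y
  · obtain ⟨x, y, hxy⟩ := hedge
    have hmin : ∀ {W : Type} (H : SimpleGraph W), GM.Has H G Set.univ → IsMinorOf H G := by
      rintro W H ⟨φ, h1, h2, h3, _⟩
      exact ⟨φ, fun w => (h1 w).induce, h2, h3⟩
    have hf : GM.Free G Set.univ := ⟨fun h => h5 (hmin _ h), fun h => h33 (hmin _ h)⟩
    obtain ⟨t, P, ht, hr, hs⟩ := GM.good_main _ G Set.univ x y rfl trivial trivial hxy hf
    rw [Set.ncard_univ, Nat.card_eq_fintype_card] at ht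
    have hp := (GM.Pic.start x y hxy.ne).run hr (by
      rw [Set.disjoint_right]
      exact fun a ha => ha.2)
    have hu : ({x, y} : Set V) ∪ Set.univ \ {x, y} = Set.univ := by simp
    rw [hu] at hp
    refine hp.minor (fun u v huv => ?_) (by omega) (by omega)
    rcases hs u trivial v trivial huv with h | h
    · exact Or.inl (Or.inr h)
    · exact Or.inr (Or.inr h)
  · push Not at hedge
    let f : V → Fin (4 * Fintype.card V) := fun v =>
      ⟨(Fintype.equivFin V v : ℕ), by have := (Fintype.equivFin V v).2; omega⟩
    have hfi : Function.Injective f := by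
      intro a b hab
      simp only [f, Fin.mk.injEq] at hab
      exact (Fintype.equivFin V).injective (Fin.ext hab)
    refine ⟨fun v => {(f v, f v)}, fun v => (GM.Conn.singleton _).induce, ?_, ?_⟩
    · intro a b hab
      rw [Set.disjoint_singleton]
      intro h
      exact hab (hfi (Prod.mk.inj h).1)
    · intro a b hab
      exact absurd hab (hedge a b)
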